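/- For every real number X there exist real numbers x > X and y > X such that Δ(x) > 0 and Δ(y) < 0, where Δ(x) = Σ_{p ≤ x} (log p)/p − (log x + E); that is, the error term in Mertens's first theorem changes sign infinitely often. -/

import Mathlib

/-- The Mertens constant `E = −γ − Σ_p (log p)/(p(p−1))`, the sum running over all
primes. -/
noncomputable def mertensE : ℝ :=
  -Real.eulerMascheroniConstant -
    ∑' p : Nat.Primes, Real.log (p : ℕ) / (((p : ℕ) : ℝ) * (((p : ℕ) : ℝ) - 1))

/-- The error term in Mertens's first theorem,
`Δ(x) = Σ_{p ≤ x} (log p)/p − (log x + E)`. -/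
noncomputable def mertensDelta (x : ℝ) : ℝ :=
  (∑ p ∈ (Finset.range (⌊x⌋₊ + 1)).filter Nat.Prime, Real.log p / (p : ℝ)) -
    (Real.log x + mertensE)

open Filter Topology Metric MeasureTheory ProbabilityTheory

/-- An entire function divided by the full power of `z - ρ` is entire and nonzero at `ρ`. -/
lemma exists_differentiable_eq_pow_mul {f : ℂ → ℂ} (hf : Differentiable ℂ f) {ρ : ℂ}
    (hord : analyticOrderAt f ρ ≠ ⊤) :
    ∃ g : ℂ → ℂ, Differentiable ℂ g ∧ g ρ ≠ 0 ∧
      ∀ z, f z = (z - ρ) ^ analyticOrderNatAt f ρ * g z := by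
  obtain ⟨g₀, hg₀, hg₀ρ, hfg⟩ := (hf.analyticAt ρ).analyticOrderAt_ne_top.1 hord
  set n := analyticOrderNatAt f ρ
  set g := Function.update (fun z ↦ f z / (z - ρ) ^ n) ρ (g₀ ρ) with hg
  have hne : ∀ z, z ≠ ρ → g z = f z / (z - ρ) ^ n := fun z hz ↦ by
    simp [hg, Function.update_of_ne hz]
  have hρ : g ρ = g₀ ρ := by simp [hg]
  refine ⟨g, fun z ↦ ?_, by rwa [hρ], fun z ↦ ?_⟩
  · rcases eq_or_ne z ρ with rfl | hz
    · have : g =ᶠ[𝓝 z] g₀ := by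
        filter_upwards [hfg] with w hw
        rcases eq_or_ne w z with rfl | hwz
        · exact hρ
        · rw [hne w hwz, hw, smul_eq_mul, mul_div_cancel_left₀]
          exact pow_ne_zero _ (sub_ne_zero.2 hwz)
      exact hg₀.differentiableAt.congr_of_eventuallyEq this
    · have : g =ᶠ[𝓝 z] fun z ↦ f z / (z - ρ) ^ n := by
        filter_upwards [isOpen_ne.mem_nhds hz] with w hw using hne w hw
      refine DifferentiableAt.congr_of_eventuallyEq ?_ this
      exact (hf z).div (by fun_prop) (pow_ne_zero _ (sub_ne_zero.2 hz))
  · rcases eq_or_ne z ρ with rfl | hz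
    · rw [hρ]; exact hfg.self_of_nhds
    · rw [hne z hz, mul_div_cancel₀]
      exact pow_ne_zero _ (sub_ne_zero.2 hz)

/-- Finitely many zeros of an entire function can be divided out simultaneously. -/
lemma exists_differentiable_eq_prod_mul {f : ℂ → ℂ} (hf : Differentiable ℂ f)
    (hord : ∀ ρ, analyticOrderAt f ρ ≠ ⊤) (Z : Finset ℂ) :
    ∃ g : ℂ → ℂ, Differentiable ℂ g ∧ (∀ ρ ∈ Z, g ρ ≠ 0) ∧
      ∀ z, f z = (∏ ρ ∈ Z, (z - ρ) ^ analyticOrderNatAt f ρ) * g z := by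
  classical
  induction Z using Finset.induction_on with
  | empty => exact ⟨f, hf, by simp, by simp⟩
  | insert ρ Z hρ ih =>
    obtain ⟨g, hg, hgZ, hfg⟩ := ih
    set Q : ℂ → ℂ := fun z ↦ ∏ ρ ∈ Z, (z - ρ) ^ analyticOrderNatAt f ρ with hQ
    have hQd : Differentiable ℂ Q := by simp only [hQ]; fun_prop
    have hQρ : Q ρ ≠ 0 := Finset.prod_ne_zero_iff.2 fun a ha ↦
      pow_ne_zero _ (sub_ne_zero.2 fun h ↦ hρ (h ▸ ha))
    have hordg : analyticOrderAt g ρ = analyticOrderAt f ρ := by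
      have hfQ : f = Q * g := funext hfg
      rw [hfQ, analyticOrderAt_mul (hQd.analyticAt ρ) (hg.analyticAt ρ),
        (hQd.analyticAt ρ).analyticOrderAt_eq_zero.2 hQρ, zero_add]
    obtain ⟨k, hk, hkρ, hgk⟩ := exists_differentiable_eq_pow_mul hg (hordg ▸ hord ρ)
    refine ⟨k, hk, fun a ha ↦ ?_, fun z ↦ ?_⟩
    · rcases Finset.mem_insert.1 ha with rfl | ha
      · exact hkρ
      · intro h
        exact hgZ a ha (by rw [hgk, h, mul_zero])
    · rw [Finset.prod_insert hρ, hfg, hgk, analyticOrderNatAt, hordg, ← analyticOrderNatAt]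
      ring

/-- A zero-free function on a disc bounded by `exp A` has a slowly varying logarithmic
derivative near the centre. -/
lemma norm_logDeriv_sub_le {k : ℂ → ℂ} {R A : ℝ} (hR : 0 < R) (hA : 0 < A)
    (hk : DifferentiableOn ℂ k (ball 0 R)) (hk0 : k 0 = 1) (hne : ∀ z ∈ ball 0 R, k z ≠ 0)
    (hbd : ∀ z ∈ ball 0 R, ‖k z‖ ≤ Real.exp A) {w : ℂ} (hw : ‖w‖ < R / 8) :
    ‖logDeriv k w - logDeriv k 0‖ ≤ 128 * A / R ^ 2 * ‖w‖ := by
  have hlog : DifferentiableOn ℂ (logDeriv k) (ball 0 R) := by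
    have := hk.deriv isOpen_ball
    exact this.div hk hne
  obtain ⟨l₀, hl₀⟩ := hlog.isExactOn_ball
  set l : ℂ → ℂ := fun z ↦ l₀ z - l₀ 0 with hldef
  have hl : ∀ z ∈ ball (0 : ℂ) R, HasDerivAt l (logDeriv k z) z := fun z hz ↦
    (hl₀ z hz).sub_const _
  have hl0 : l 0 = 0 := by simp [hldef]
  have h0 : (0 : ℂ) ∈ ball (0 : ℂ) R := mem_ball_self hR
  have hld : DifferentiableOn ℂ l (ball 0 R) := fun z hz ↦
    (hl z hz).differentiableAt.differentiableWithinAt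
  have hexp : ∀ z ∈ ball (0 : ℂ) R, k z = Complex.exp (l z) := by
    intro z hz
    have hder : ∀ z ∈ ball (0 : ℂ) R, HasDerivAt (fun z ↦ k z * Complex.exp (-l z)) 0 z := by
      intro z hz
      have h1 := (hk.differentiableAt (isOpen_ball.mem_nhds hz)).hasDerivAt
      have h2 := (hl z hz).neg.cexp
      refine (h1.mul h2).congr_deriv ?_
      rw [logDeriv_apply]
      field_simp [hne z hz]
      simp
    have := isOpen_ball.is_const_of_deriv_eq_zero (convex_ball (0 : ℂ) R).isPreconnected
      (fun z hz ↦ (hder z hz).differentiableAt.differentiableWithinAt)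
      (fun z hz ↦ (hder z hz).deriv) hz h0
    simp only [hl0, hk0, neg_zero, Complex.exp_zero, mul_one] at this
    rw [Complex.exp_neg] at this
    field_simp at this
    exact this
  have hre : Set.MapsTo l (ball 0 R) {z | z.re ≤ A} := by
    intro z hz
    have := hbd z hz
    rw [hexp z hz, Complex.norm_exp, Real.exp_le_exp] at this
    exact this
  have hlb : ∀ z ∈ ball (0 : ℂ) (R / 2), ‖l z‖ ≤ 2 * A := by
    intro z hz
    rw [mem_ball_zero_iff] at hz
    refine (Complex.borelCaratheodory_zero hA hld hre hR
      (mem_ball_zero_iff.2 (by linarith)) hl0).trans ?_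
    rw [div_le_iff₀ (by linarith)]
    nlinarith
  have hderivl : ∀ z ∈ ball (0 : ℂ) R, deriv l z = logDeriv k z := fun z hz ↦ (hl z hz).deriv
  have hb1 : ∀ z ∈ ball (0 : ℂ) (R / 4), ‖logDeriv k z‖ ≤ 16 * A / R := by
    intro z hz
    rw [mem_ball_zero_iff] at hz
    rw [← hderivl z (mem_ball_zero_iff.2 (by linarith))]
    have hsub : closedBall z (R / 8) ⊆ ball 0 (R / 2) := by
      intro y hy
      rw [mem_closedBall, dist_eq_norm] at hy
      rw [mem_ball_zero_iff]
      linarith [norm_le_norm_add_norm_sub' y z]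
    have := Complex.norm_deriv_le_of_forall_mem_sphere_norm_le (f := l) (c := z) (R := R / 8)
      (C := 2 * A) (by linarith)
      ((hld.mono (hsub.trans (ball_subset_ball (by linarith)))).diffContOnCl_ball subset_rfl)
      (fun y hy ↦ hlb y (hsub (sphere_subset_closedBall hy)))
    refine this.trans (le_of_eq ?_)
    field_simp; ring
  have hb2 : ∀ z ∈ ball (0 : ℂ) (R / 8), ‖deriv (logDeriv k) z‖ ≤ 128 * A / R ^ 2 := by
    intro z hz
    rw [mem_ball_zero_iff] at hz
    have hsub : closedBall z (R / 8) ⊆ ball 0 (R / 4) := by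
      intro y hy
      rw [mem_closedBall, dist_eq_norm] at hy
      rw [mem_ball_zero_iff]
      linarith [norm_le_norm_add_norm_sub' y z]
    have := Complex.norm_deriv_le_of_forall_mem_sphere_norm_le (f := logDeriv k) (c := z)
      (R := R / 8) (C := 16 * A / R) (by linarith)
      ((hlog.mono (hsub.trans (ball_subset_ball (by linarith)))).diffContOnCl_ball subset_rfl)
      (fun y hy ↦ hb1 y (hsub (sphere_subset_closedBall hy)))
    refine this.trans (le_of_eq ?_)
    field_simp; ring
  have := (convex_ball (0 : ℂ) (R / 8)).norm_image_sub_le_of_norm_deriv_le (f := logDeriv k)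
    (fun z hz ↦ hlog.differentiableAt (isOpen_ball.mem_nhds
      (ball_subset_ball (by linarith) hz))) hb2 (mem_ball_self (by linarith))
    (mem_ball_zero_iff.2 hw)
  simpa using this

/-- An entire function that does not vanish identically has finite order everywhere. -/
lemma analyticOrderAt_ne_top_of_differentiable {f : ℂ → ℂ} (hf : Differentiable ℂ f) {z₀ : ℂ}
    (h0 : f z₀ ≠ 0) (ρ : ℂ) : analyticOrderAt f ρ ≠ ⊤ := by
  intro h
  rw [analyticOrderAt_eq_top] at h
  have han : AnalyticOnNhd ℂ f Set.univ := fun z _ ↦ hf.analyticAt z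
  have := han.eqOn_zero_of_preconnected_of_eventuallyEq_zero isPreconnected_univ (Set.mem_univ ρ) h
  exact h0 (this (Set.mem_univ z₀))

/-- A nonzero entire function has finitely many zeros in each disc. -/
lemma finite_zeros_closedBall {f : ℂ → ℂ} (hf : Differentiable ℂ f) {z₀ : ℂ}
    (h0 : f z₀ ≠ 0) (R : ℝ) : {ρ | f ρ = 0 ∧ ‖ρ‖ ≤ R}.Finite := by
  by_contra hinf
  have hsub : {ρ | f ρ = 0 ∧ ‖ρ‖ ≤ R} ⊆ closedBall 0 R := fun ρ hρ ↦ by simpa using hρ.2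
  obtain ⟨z, -, hz⟩ := Set.Infinite.exists_accPt_of_subset_isCompact hinf
    (isCompact_closedBall (0 : ℂ) R) hsub
  have hfreq : ∃ᶠ w in 𝓝[≠] z, f w = 0 := by
    rw [accPt_iff_frequently_nhdsNE] at hz
    exact hz.mono fun w hw ↦ hw.1
  have han : AnalyticOnNhd ℂ f Set.univ := fun z _ ↦ hf.analyticAt z
  have := han.eqOn_zero_of_preconnected_of_frequently_eq_zero isPreconnected_univ (Set.mem_univ z) hfreq
  exact h0 (this (Set.mem_univ z₀))

/-- The zeros of `f` in the closed disc of radius `R` about the origin, as a finset. -/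
noncomputable def zerosInDisc {f : ℂ → ℂ} (hf : Differentiable ℂ f) (h0 : f 0 ≠ 0) (R : ℝ) :
    Finset ℂ := (finite_zeros_closedBall hf h0 R).toFinset

lemma mem_zerosInDisc {f : ℂ → ℂ} (hf : Differentiable ℂ f) (h0 : f 0 ≠ 0) {R : ℝ} {ρ : ℂ} :
    ρ ∈ zerosInDisc hf h0 R ↔ f ρ = 0 ∧ ‖ρ‖ ≤ R := by
  simp [zerosInDisc]

lemma analyticOrderNatAt_eq_zero_of_ne {f : ℂ → ℂ} (hf : Differentiable ℂ f) {z : ℂ}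
    (hz : f z ≠ 0) : analyticOrderNatAt f z = 0 := by
  simp [analyticOrderNatAt, (hf.analyticAt z).analyticOrderAt_eq_zero.2 hz]

/-- Dividing out the zeros in the disc of radius `R` controls both their number and the
remaining factor. -/
lemma exists_zeroFree_factor {f : ℂ → ℂ} (hf : Differentiable ℂ f) (h0 : f 0 ≠ 0)
    {R M : ℝ} (hR : 0 < R) (hM : ∀ z, ‖z‖ = 4 * R → ‖f z‖ ≤ M) :
    ∃ k : ℂ → ℂ, Differentiable ℂ k ∧ k 0 = 1 ∧ (∀ z ∈ ball 0 R, k z ≠ 0) ∧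
      (∀ z ∈ ball 0 (4 * R), ‖k z‖ * 3 ^ (∑ ρ ∈ zerosInDisc hf h0 R, analyticOrderNatAt f ρ) ≤
        M / ‖f 0‖) ∧
      ∀ w, f w ≠ 0 → logDeriv f w =
        (∑ ρ ∈ zerosInDisc hf h0 R, (analyticOrderNatAt f ρ : ℂ) / (w - ρ)) + logDeriv k w := by
  set Z := zerosInDisc hf h0 R with hZ
  obtain ⟨g, hg, hgZ, hfg⟩ := exists_differentiable_eq_prod_mul hf
    (analyticOrderAt_ne_top_of_differentiable hf h0) Z
  set Q : ℂ → ℂ := fun z ↦ ∏ ρ ∈ Z, (z - ρ) ^ analyticOrderNatAt f ρ with hQ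
  set n := ∑ ρ ∈ Z, analyticOrderNatAt f ρ with hn
  have hfQ : ∀ z, f z = Q z * g z := hfg
  have hg0 : g 0 ≠ 0 := fun h ↦ h0 (by rw [hfQ, h, mul_zero])
  have hQ0 : Q 0 ≠ 0 := fun h ↦ h0 (by rw [hfQ, h, zero_mul])
  have hQlow : ∀ z, ‖z‖ = 4 * R → ‖Q 0‖ * 3 ^ n ≤ ‖Q z‖ := by
    intro z hz
    simp only [hQ, hn, norm_prod, norm_pow, zero_sub, norm_neg, ← Finset.prod_pow_eq_pow_sum,
      ← Finset.prod_mul_distrib, ← mul_pow]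
    refine Finset.prod_le_prod (fun _ _ ↦ by positivity) fun ρ hρ ↦ ?_
    have hρR : ‖ρ‖ ≤ R := ((mem_zerosInDisc hf h0).1 hρ).2
    gcongr
    have := norm_sub_norm_le z ρ
    linarith
  have hbound : ∀ z ∈ closure (ball (0 : ℂ) (4 * R)), ‖g z‖ ≤ M / (‖Q 0‖ * 3 ^ n) := by
    intro z hz
    refine Complex.norm_le_of_forall_mem_frontier_norm_le isBounded_ball hg.diffContOnCl ?_ hz
    intro y hy
    rw [frontier_ball _ (by positivity), mem_sphere_zero_iff_norm] at hy
    rw [le_div_iff₀ (by positivity)]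
    have := hM y hy
    rw [hfQ, norm_mul] at this
    nlinarith [hQlow y hy, norm_nonneg (g y)]
  refine ⟨fun z ↦ g z / g 0, hg.div_const _, div_self hg0, fun z hz ↦ ?_, fun z hz ↦ ?_,
    fun w hw ↦ ?_⟩
  · refine div_ne_zero ?_ hg0
    intro h
    have hzf : f z = 0 := by rw [hfQ, h, mul_zero]
    refine hgZ z ((mem_zerosInDisc hf h0).2 ⟨hzf, ?_⟩) h
    exact (mem_ball_zero_iff.1 hz).le
  · have h1 := hbound z (subset_closure hz)
    have h2 : ‖f 0‖ = ‖Q 0‖ * ‖g 0‖ := by rw [hfQ, norm_mul]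
    rw [norm_div, h2]
    rw [le_div_iff₀ (by positivity)] at h1 ⊢
    calc _ = ‖g z‖ * (‖Q 0‖ * 3 ^ n) := by field_simp
      _ ≤ M := h1
  · have hQw : Q w ≠ 0 := fun h ↦ hw (by rw [hfQ, h, zero_mul])
    have hgw : g w ≠ 0 := fun h ↦ hw (by rw [hfQ, h, mul_zero])
    have hne : ∀ ρ ∈ Z, (w - ρ) ^ analyticOrderNatAt f ρ ≠ 0 := Finset.prod_ne_zero_iff.1 hQw
    have hQd : DifferentiableAt ℂ Q w := by simp only [hQ]; fun_prop
    have e1 : logDeriv f w = logDeriv Q w + logDeriv g w := by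
      rw [← logDeriv_mul w hQw hgw hQd (hg w)]
      congr 1
      exact funext hfQ
    have e2 : logDeriv Q w = ∑ ρ ∈ Z, (analyticOrderNatAt f ρ : ℂ) / (w - ρ) := by
      simp only [hQ]
      rw [logDeriv_prod hne (fun _ _ ↦ by fun_prop)]
      refine Finset.sum_congr rfl fun ρ _ ↦ ?_
      rw [logDeriv_fun_pow (by fun_prop), logDeriv_apply]
      simp [div_eq_mul_inv]
    have e3 : logDeriv (fun z ↦ g z / g 0) w = logDeriv g w := by
      simp only [div_eq_mul_inv]
      exact logDeriv_mul_const w _ (inv_ne_zero hg0)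
    rw [e1, e2, e3]

/-- Zero counting and the truncated partial fraction expansion of `f' / f` for an entire
function of order at most `3 / 2`. -/
lemma exists_zero_count_and_logDeriv_bound {f : ℂ → ℂ} (hf : Differentiable ℂ f) (h0 : f 0 ≠ 0)
    {C : ℝ} (hC : 0 < C) (hgrowth : ∀ z, 1 ≤ ‖z‖ → ‖f z‖ ≤ Real.exp (C * ‖z‖ ^ (3 / 2 : ℝ))) :
    ∃ D : ℝ, 0 < D ∧ ∀ K : ℕ,
      (∑ ρ ∈ zerosInDisc hf h0 (4 ^ K), (analyticOrderNatAt f ρ : ℝ) ≤ D * 8 ^ K) ∧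
      ∀ w, f w ≠ 0 → ‖w‖ < 4 ^ K / 8 →
        ‖(logDeriv f w - logDeriv f 0) - ∑ ρ ∈ zerosInDisc hf h0 (4 ^ K),
          (analyticOrderNatAt f ρ : ℂ) * (1 / (w - ρ) + 1 / ρ)‖ ≤ 128 * D / 2 ^ K * ‖w‖ := by
  set D := 8 * C + |Real.log ‖f 0‖| + 1 with hD
  have hDpos : 0 < D := by positivity
  refine ⟨D, hDpos, fun K ↦ ?_⟩
  have hpow : ((4 : ℝ) * 4 ^ K) ^ (3 / 2 : ℝ) = 8 * 8 ^ K := by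
    have h4 : (4 : ℝ) * 4 ^ K = (2 * 2 ^ K) ^ 2 := by
      rw [mul_pow, ← pow_mul, mul_comm K 2, pow_mul]; norm_num
    rw [h4, ← Real.rpow_natCast, ← Real.rpow_mul (by positivity),
      show ((2 : ℕ) : ℝ) * (3 / 2) = ((3 : ℕ) : ℝ) by norm_num, Real.rpow_natCast, mul_pow,
      ← pow_mul, mul_comm K 3, pow_mul]
    norm_num
  obtain ⟨k, hk, hk0, hkne, hkb, hklog⟩ := exists_zeroFree_factor hf h0 (R := 4 ^ K)
    (M := Real.exp (C * (8 * 8 ^ K))) (by positivity) (fun z hz ↦ by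
      rw [← hpow, ← hz]
      exact hgrowth z (by rw [hz]; nlinarith [one_le_pow₀ (n := K) (show (1 : ℝ) ≤ 4 by norm_num)]))
  set n := ∑ ρ ∈ zerosInDisc hf h0 (4 ^ K), analyticOrderNatAt f ρ with hn
  have h8 : (1 : ℝ) ≤ 8 ^ K := one_le_pow₀ (by norm_num)
  have hf0 : 0 < ‖f 0‖ := norm_pos_iff.2 h0
  have hM : Real.exp (C * (8 * 8 ^ K)) / ‖f 0‖ ≤ Real.exp (D * 8 ^ K) := by
    rw [div_le_iff₀ hf0, ← Real.exp_log hf0, ← Real.exp_add, Real.exp_le_exp, hD]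
    nlinarith [neg_abs_le (Real.log ‖f 0‖), abs_nonneg (Real.log ‖f 0‖)]
  constructor
  · have h1 := (hkb 0 (mem_ball_self (by positivity))).trans hM
    rw [hk0, norm_one, one_mul] at h1
    have h2 : Real.exp n ≤ 3 ^ n := by
      rw [← mul_one (n : ℝ), Real.exp_nat_mul]
      gcongr
      linarith [Real.exp_one_lt_d9]
    have := Real.exp_le_exp.1 (h2.trans h1)
    rw [hn] at this
    exact_mod_cast this
  · intro w hw hwK
    have hlog := norm_logDeriv_sub_le (k := k) (R := 4 ^ K) (A := D * 8 ^ K) (by positivity)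
      (by positivity) hk.differentiableOn hk0 hkne (fun z hz ↦ by
        have hz' : z ∈ ball (0 : ℂ) (4 * 4 ^ K) := ball_subset_ball (by
          linarith [show (0 : ℝ) < 4 ^ K by positivity]) hz
        have := (hkb z hz').trans hM
        have h3 : (1 : ℝ) ≤ 3 ^ n := one_le_pow₀ (by norm_num)
        nlinarith [norm_nonneg (k z)]) hwK
    have hconst : 128 * (D * 8 ^ K) / (4 ^ K : ℝ) ^ 2 = 128 * D / 2 ^ K := by
      rw [← pow_mul, mul_comm K 2, pow_mul, show (4 : ℝ) ^ 2 = 8 * 2 by norm_num, mul_pow]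
      field_simp
    rw [hconst] at hlog
    convert hlog using 2
    rw [hklog w hw, hklog 0 h0]
    simp only [mul_add, Finset.sum_add_distrib, zero_sub, div_neg, Finset.sum_neg_distrib,
      mul_one_div]
    ring

/-- The zeros of an entire function of order at most `3 / 2` satisfy `∑ 1 / ‖ρ‖ ^ 2 < ∞`. -/
lemma summable_order_div_sq {f : ℂ → ℂ} (hf : Differentiable ℂ f) (h0 : f 0 ≠ 0)
    {C : ℝ} (hC : 0 < C) (hgrowth : ∀ z, 1 ≤ ‖z‖ → ‖f z‖ ≤ Real.exp (C * ‖z‖ ^ (3 / 2 : ℝ))) :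
    Summable fun ρ : ℂ ↦ (analyticOrderNatAt f ρ : ℝ) / ‖ρ‖ ^ 2 := by
  obtain ⟨D, hD, hDK⟩ := exists_zero_count_and_logDeriv_bound hf h0 hC hgrowth
  have hmono : ∀ {R S : ℝ}, R ≤ S → zerosInDisc hf h0 R ⊆ zerosInDisc hf h0 S := by
    intro R S hRS ρ hρ
    rw [mem_zerosInDisc] at hρ ⊢
    exact ⟨hρ.1, hρ.2.trans hRS⟩
  set A := ∑ ρ ∈ zerosInDisc hf h0 (4 ^ 0), (analyticOrderNatAt f ρ : ℝ) / ‖ρ‖ ^ 2 with hA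
  have hpart : ∀ K : ℕ, ∑ ρ ∈ zerosInDisc hf h0 (4 ^ K), (analyticOrderNatAt f ρ : ℝ) / ‖ρ‖ ^ 2
      ≤ A + 16 * D * (1 - 1 / 2 ^ K) := by
    intro K
    induction K with
    | zero => simp [hA]
    | succ K ih =>
      have hsub : zerosInDisc hf h0 (4 ^ K) ⊆ zerosInDisc hf h0 (4 ^ (K + 1)) :=
        hmono (pow_le_pow_right₀ (by norm_num) (Nat.le_succ K))
      rw [← Finset.sum_sdiff hsub]
      have hannulus : ∑ ρ ∈ zerosInDisc hf h0 (4 ^ (K + 1)) \ zerosInDisc hf h0 (4 ^ K),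
          (analyticOrderNatAt f ρ : ℝ) / ‖ρ‖ ^ 2 ≤ 8 * D / 2 ^ K := by
        calc _ ≤ ∑ ρ ∈ zerosInDisc hf h0 (4 ^ (K + 1)) \ zerosInDisc hf h0 (4 ^ K),
              (analyticOrderNatAt f ρ : ℝ) / 16 ^ K := by
              refine Finset.sum_le_sum fun ρ hρ ↦ ?_
              rw [Finset.mem_sdiff, mem_zerosInDisc, mem_zerosInDisc] at hρ
              have hlt : 4 ^ K < ‖ρ‖ := lt_of_not_ge fun h ↦ hρ.2 ⟨hρ.1.1, h⟩
              gcongr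
              calc (16 : ℝ) ^ K = (4 ^ K) ^ 2 := by rw [← pow_mul, mul_comm, pow_mul]; norm_num
                _ ≤ ‖ρ‖ ^ 2 := by gcongr
          _ ≤ ∑ ρ ∈ zerosInDisc hf h0 (4 ^ (K + 1)), (analyticOrderNatAt f ρ : ℝ) / 16 ^ K :=
              Finset.sum_le_sum_of_subset_of_nonneg Finset.sdiff_subset
                fun _ _ _ ↦ by positivity
          _ ≤ D * 8 ^ (K + 1) / 16 ^ K := by
              rw [← Finset.sum_div]
              gcongr
              exact (hDK (K + 1)).1
          _ = 8 * D / 2 ^ K := by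
              rw [show (16 : ℝ) = 8 * 2 by norm_num, mul_pow]
              field_simp
              ring
      have : 16 * D * (1 - 1 / 2 ^ (K + 1)) = 16 * D * (1 - 1 / 2 ^ K) + 8 * D / 2 ^ K := by
        field_simp
        ring
      linarith
  refine summable_of_sum_le (c := A + 16 * D) (fun ρ ↦ by positivity) fun u ↦ ?_
  obtain ⟨K, hK⟩ := (tendsto_pow_atTop_atTop_of_one_lt (show (1 : ℝ) < 4 by norm_num)
    |>.eventually_ge_atTop (∑ ρ ∈ u, ‖ρ‖)).exists
  calc ∑ ρ ∈ u, (analyticOrderNatAt f ρ : ℝ) / ‖ρ‖ ^ 2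
      ≤ ∑ ρ ∈ u ∪ zerosInDisc hf h0 (4 ^ K), (analyticOrderNatAt f ρ : ℝ) / ‖ρ‖ ^ 2 :=
        Finset.sum_le_sum_of_subset_of_nonneg Finset.subset_union_left fun _ _ _ ↦ by positivity
    _ = ∑ ρ ∈ zerosInDisc hf h0 (4 ^ K), (analyticOrderNatAt f ρ : ℝ) / ‖ρ‖ ^ 2 := by
        refine (Finset.sum_subset Finset.subset_union_right fun ρ hρ hρ' ↦ ?_).symm
        have hρu : ρ ∈ u := (Finset.mem_union.1 hρ).resolve_right hρ'
        have hfρ : f ρ ≠ 0 := fun h ↦ hρ' <| (mem_zerosInDisc hf h0).2 ⟨h,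
          (Finset.single_le_sum (fun ρ _ ↦ norm_nonneg ρ) hρu).trans hK⟩
        simp [analyticOrderNatAt_eq_zero_of_ne hf hfρ]
    _ ≤ A + 16 * D * (1 - 1 / 2 ^ K) := hpart K
    _ ≤ A + 16 * D := by
        have : 0 ≤ 16 * D * (1 / 2 ^ K) := by positivity
        linarith

/-- Partial fraction expansion of the logarithmic derivative of an entire function of order at
most `3 / 2`. -/
lemma hasSum_logDeriv_sub {f : ℂ → ℂ} (hf : Differentiable ℂ f) (h0 : f 0 ≠ 0)
    {C : ℝ} (hC : 0 < C) (hgrowth : ∀ z, 1 ≤ ‖z‖ → ‖f z‖ ≤ Real.exp (C * ‖z‖ ^ (3 / 2 : ℝ)))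
    {w : ℂ} (hw : f w ≠ 0) :
    HasSum (fun ρ : ℂ ↦ (analyticOrderNatAt f ρ : ℂ) * (1 / (w - ρ) + 1 / ρ))
      (logDeriv f w - logDeriv f 0) := by
  obtain ⟨D, hD, hDK⟩ := exists_zero_count_and_logDeriv_bound hf h0 hC hgrowth
  set F := fun ρ : ℂ ↦ (analyticOrderNatAt f ρ : ℂ) * (1 / (w - ρ) + 1 / ρ) with hF
  have hF0 : ∀ ρ, f ρ ≠ 0 → F ρ = 0 := fun ρ hρ ↦ by
    simp [hF, analyticOrderNatAt_eq_zero_of_ne hf hρ]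
  have hsum : Summable F := by
    refine Summable.of_norm_bounded_eventually
      ((summable_order_div_sq hf h0 hC hgrowth).mul_left (2 * ‖w‖)) ?_
    refine (finite_zeros_closedBall hf h0 (2 * ‖w‖)).subset fun ρ hρ ↦ ?_
    simp only [Set.mem_compl_iff, Set.mem_ofPred_eq] at hρ ⊢
    by_contra hcon
    apply hρ
    by_cases hfρ : f ρ = 0
    · have hlt : 2 * ‖w‖ < ‖ρ‖ := lt_of_not_ge fun h ↦ hcon ⟨hfρ, h⟩
      have hρ0 : ρ ≠ 0 := fun h ↦ h0 (h ▸ hfρ)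
      have hwρ : w - ρ ≠ 0 := fun h ↦ hw (by rwa [sub_eq_zero.1 h])
      have hρpos : 0 < ‖ρ‖ := norm_pos_iff.2 hρ0
      have hlow : ‖ρ‖ / 2 ≤ ‖w - ρ‖ := by
        have := norm_sub_norm_le ρ w
        rw [norm_sub_rev] at this
        linarith
      have e : F ρ = (analyticOrderNatAt f ρ : ℂ) * (w / ((w - ρ) * ρ)) := by
        simp only [hF]
        field_simp
        ring
      rw [e, norm_mul, norm_div, norm_mul, Complex.norm_natCast]
      calc (analyticOrderNatAt f ρ : ℝ) * (‖w‖ / (‖w - ρ‖ * ‖ρ‖))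
          ≤ (analyticOrderNatAt f ρ : ℝ) * (‖w‖ / (‖ρ‖ / 2 * ‖ρ‖)) := by gcongr
        _ = _ := by field_simp
    · rw [hF0 ρ hfρ, norm_zero]
      positivity
  have hfour : Tendsto (fun K : ℕ ↦ (4 : ℝ) ^ K) atTop atTop :=
    tendsto_pow_atTop_atTop_of_one_lt (by norm_num)
  have hlim : Tendsto (fun K : ℕ ↦ ∑ ρ ∈ zerosInDisc hf h0 (4 ^ K), F ρ) atTop
      (𝓝 (∑' ρ, F ρ)) := by
    have := tendsto_tsum_of_dominated_convergence (𝓕 := atTop)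
      (f := fun (K : ℕ) ρ ↦ Set.indicator (zerosInDisc hf h0 (4 ^ K) : Set ℂ) F ρ) (g := F)
      hsum.norm (fun ρ ↦ ?_) (Eventually.of_forall fun K ρ ↦ norm_indicator_le_norm_self _ _)
    · simpa only [Finset.tsum_subtype', ← tsum_subtype, Finset.tsum_subtype] using this
    · refine tendsto_const_nhds.congr' ?_
      filter_upwards [hfour.eventually_ge_atTop ‖ρ‖] with K hK
      by_cases hfρ : f ρ = 0
      · rw [Set.indicator_of_mem]
        exact_mod_cast (mem_zerosInDisc hf h0).2 ⟨hfρ, hK⟩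
      · by_cases hm : ρ ∈ (zerosInDisc hf h0 (4 ^ K) : Set ℂ)
        · rw [Set.indicator_of_mem hm]
        · rw [Set.indicator_of_notMem hm, hF0 ρ hfρ]
  have hlim' : Tendsto (fun K : ℕ ↦ ∑ ρ ∈ zerosInDisc hf h0 (4 ^ K), F ρ) atTop
      (𝓝 (logDeriv f w - logDeriv f 0)) := by
    rw [tendsto_iff_norm_sub_tendsto_zero]
    have hz : Tendsto (fun K : ℕ ↦ 128 * D / 2 ^ K * ‖w‖) atTop (𝓝 0) := by
      have := (tendsto_const_nhds (x := 128 * D)).div_atTop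
        (tendsto_pow_atTop_atTop_of_one_lt (show (1 : ℝ) < 2 by norm_num))
      simpa using this.mul_const ‖w‖
    refine squeeze_zero' (Eventually.of_forall fun _ ↦ norm_nonneg _) ?_ hz
    filter_upwards [hfour.eventually_gt_atTop (8 * ‖w‖)] with K hK
    rw [norm_sub_rev]
    exact (hDK K).2 w hw (by linarith)
  rw [← tendsto_nhds_unique hlim hlim']
  exact hsum.hasSum

/-- The measure `G t dt / t` on `(1, ∞)`; its exponential moments against `-log t` are the
Mellin-type transforms `∫ G t * t ^ (-(s + 1)) dt`. -/
noncomputable def mellinMeasure (G : ℝ → ℝ) : Measure ℝ :=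
  (volume.restrict (Set.Ioi 1)).withDensity fun t ↦ ENNReal.ofReal (G t / t)

lemma complexMGF_mellinMeasure {G : ℝ → ℝ} (hG : Measurable G) (hG0 : ∀ t, 1 < t → 0 ≤ G t)
    (s : ℂ) :
    complexMGF (fun t ↦ -Real.log t) (mellinMeasure G) s =
      ∫ t in Set.Ioi (1 : ℝ), (G t : ℂ) * (t : ℂ) ^ (-(s + 1)) := by
  rw [complexMGF, mellinMeasure, integral_withDensity_eq_integral_toReal_smul (by fun_prop)
    (Eventually.of_forall fun _ ↦ ENNReal.ofReal_lt_top)]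
  refine setIntegral_congr_fun measurableSet_Ioi fun t ht ↦ ?_
  have ht1 : 1 < t := ht
  have ht0 : 0 < t := by linarith
  have htc : (t : ℂ) ≠ 0 := by exact_mod_cast ht0.ne'
  rw [ENNReal.toReal_ofReal (div_nonneg (hG0 t ht1) ht0.le), Complex.cpow_def_of_ne_zero htc,
    ← Complex.ofReal_log ht0.le, Complex.real_smul,
    show (Real.log t : ℂ) * -(s + 1) = s * (-Real.log t : ℝ) + -(Real.log t : ℂ) by
      push_cast; ring,
    Complex.exp_add, Complex.exp_neg (Real.log t : ℂ), ← Complex.ofReal_exp, Real.exp_log ht0]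
  push_cast
  ring

lemma mem_integrableExpSet_mellinMeasure {G : ℝ → ℝ} (hG : Measurable G)
    (hG0 : ∀ t, 1 < t → 0 ≤ G t) (a : ℝ) :
    a ∈ integrableExpSet (fun t ↦ -Real.log t) (mellinMeasure G) ↔
      IntegrableOn (fun t ↦ G t * t ^ (-(a + 1))) (Set.Ioi 1) := by
  rw [integrableExpSet, Set.mem_ofPred_eq, mellinMeasure,
    integrable_withDensity_iff_integrable_smul' (by fun_prop)
    (Eventually.of_forall fun _ ↦ ENNReal.ofReal_lt_top), ← IntegrableOn]
  refine integrableOn_congr_fun (fun t ht ↦ ?_) measurableSet_Ioi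
  have ht1 : 1 < t := ht
  have ht0 : 0 < t := by linarith
  rw [ENNReal.toReal_ofReal (div_nonneg (hG0 t ht1) ht0.le), Real.rpow_def_of_pos ht0,
    smul_eq_mul, neg_add, mul_add, Real.exp_add, mul_neg_one, Real.exp_neg (Real.log t),
    Real.exp_log ht0]
  ring_nf

/-- A function bounded by a constant on `(1, ∞)` has a transform on `0 < a`. -/
lemma integrableOn_mul_rpow_of_bounded {G : ℝ → ℝ} (hG : Measurable G) {B : ℝ}
    (hB : ∀ t, 1 < t → |G t| ≤ B) {a : ℝ} (ha : 0 < a) :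
    IntegrableOn (fun t ↦ G t * t ^ (-(a + 1))) (Set.Ioi 1) := by
  have hInt := (integrableOn_Ioi_rpow_of_lt (show -(a + 1) < -1 by linarith)
    (show (0 : ℝ) < 1 by norm_num)).const_mul B
  refine hInt.mono' (by fun_prop) ?_
  filter_upwards [ae_restrict_mem measurableSet_Ioi] with t ht
  have ht1 : 1 < t := ht
  have ht0 : 0 < t := by linarith
  rw [norm_mul, Real.norm_eq_abs, Real.norm_of_nonneg (by positivity)]
  gcongr
  exact hB t ht1

lemma integrableOn_ofReal_mul_cpow {G : ℝ → ℝ} (hG : Measurable G) {s : ℂ}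
    (h : IntegrableOn (fun t ↦ G t * t ^ (-(s.re + 1))) (Set.Ioi 1)) :
    IntegrableOn (fun t : ℝ ↦ (G t : ℂ) * (t : ℂ) ^ (-(s + 1))) (Set.Ioi 1) := by
  refine Integrable.mono h (by fun_prop) ?_
  filter_upwards [ae_restrict_mem measurableSet_Ioi] with t ht
  have ht0 : 0 < t := lt_trans one_pos ht
  rw [norm_mul, norm_mul, Complex.norm_cpow_eq_rpow_re_of_pos ht0, Complex.norm_real,
    Real.norm_of_nonneg (Real.rpow_nonneg ht0.le _)]
  simp

/-- The Mellin-type transform of the fractional part. -/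
noncomputable def fractTransform (s : ℂ) : ℂ :=
  complexMGF (fun t ↦ -Real.log t) (mellinMeasure Int.fract) s

lemma Ioi_subset_integrableExpSet_fract :
    Set.Ioi 0 ⊆ integrableExpSet (fun t ↦ -Real.log t) (mellinMeasure Int.fract) := fun a ha ↦ by
  rw [mem_integrableExpSet_mellinMeasure measurable_fract fun t _ ↦ Int.fract_nonneg t]
  refine integrableOn_mul_rpow_of_bounded measurable_fract (B := 1) (fun t _ ↦ ?_) ha
  rw [abs_of_nonneg (Int.fract_nonneg t)]
  exact (Int.fract_lt_one t).le

lemma analyticAt_fractTransform {s : ℂ} (hs : 0 < s.re) : AnalyticAt ℂ fractTransform s :=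
  analyticAt_complexMGF (interior_mono Ioi_subset_integrableExpSet_fract (by simpa using hs))

lemma norm_fractTransform_le {s : ℂ} (hs : 0 < s.re) : ‖fractTransform s‖ ≤ 1 / s.re := by
  rw [fractTransform, complexMGF_mellinMeasure measurable_fract fun t _ ↦ Int.fract_nonneg t]
  have h1 : -(s.re + 1) < -1 := by linarith
  calc _ ≤ ∫ t in Set.Ioi (1 : ℝ), t ^ (-(s.re + 1)) := by
        refine norm_integral_le_of_norm_le (integrableOn_Ioi_rpow_of_lt h1 one_pos) ?_
        filter_upwards [ae_restrict_mem measurableSet_Ioi] with t ht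
        have ht1 : 1 < t := ht
        have ht0 : 0 < t := by linarith
        rw [norm_mul, Complex.norm_cpow_eq_rpow_re_of_pos ht0, Complex.norm_real,
          Real.norm_of_nonneg (Int.fract_nonneg t)]
        simp only [Complex.neg_re, Complex.add_re, Complex.one_re]
        exact mul_le_of_le_one_left (by positivity) (Int.fract_lt_one t).le
    _ = 1 / s.re := by
        rw [integral_Ioi_rpow_of_lt h1 one_pos]
        have : s.re ≠ 0 := hs.ne'
        simp

/-- `(s - 1) * ζ s` in terms of the transform of the fractional part, on `1 < re s`. -/
lemma riemannZeta₁_eq_of_one_lt_re {s : ℂ} (hs : 1 < s.re) :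
    riemannZeta₁ s = s - s * (s - 1) * fractTransform s := by
  have hs1 : s ≠ 1 := by rintro rfl; simp at hs
  have hs1' : s - 1 ≠ 0 := sub_ne_zero.2 hs1
  have hS := LSeries_eq_mul_integral_of_nonneg (fun _ ↦ (1 : ℝ)) (r := 1) zero_le_one hs
    (by simpa using Asymptotics.isBigO_refl _ _) (fun _ ↦ zero_le_one)
  have hz : riemannZeta s = LSeries (fun n ↦ (((1 : ℝ)) : ℂ)) s := by
    rw [← LSeries_one_eq_riemannZeta hs]
    simp only [Complex.ofReal_one]
    rfl
  have hf : riemannZeta₁ s = (s - 1) * riemannZeta s := by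
    rw [riemannZeta_eq_inv_sub_mul hs1]
    field_simp
  have hInt : ∫ t in Set.Ioi (1 : ℝ), (∑ k ∈ Finset.Icc 1 ⌊t⌋₊, ((1 : ℝ) : ℂ)) * (t : ℂ) ^ (-(s + 1))
      = 1 / (s - 1) - fractTransform s := by
    rw [fractTransform, complexMGF_mellinMeasure measurable_fract fun t _ ↦ Int.fract_nonneg t]
    have e1 : ∫ t in Set.Ioi (1 : ℝ), (t : ℂ) ^ (-s) = 1 / (s - 1) := by
      rw [integral_Ioi_cpow_of_lt (by simpa using hs) one_pos]
      rw [Complex.ofReal_one, Complex.one_cpow, show -s + 1 = -(s - 1) by ring,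
        neg_div_neg_eq]
    rw [← e1, ← integral_sub]
    · refine setIntegral_congr_fun measurableSet_Ioi fun t ht ↦ ?_
      have ht1 : 1 < t := ht
      have ht0 : 0 < t := by linarith
      have htc : (t : ℂ) ≠ 0 := by exact_mod_cast ht0.ne'
      simp only [Complex.ofReal_one, Finset.sum_const, Nat.card_Icc, nsmul_eq_mul, mul_one,
        add_tsub_cancel_right]
      have e2 : (t : ℂ) ^ (-s) = t * (t : ℂ) ^ (-(s + 1)) := by
        rw [neg_add, Complex.cpow_add _ _ htc, Complex.cpow_neg_one]
        field_simp
      have e3 : ((⌊t⌋₊ : ℕ) : ℂ) = t - (Int.fract t : ℝ) := by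
        have : ((⌊t⌋₊ : ℕ) : ℝ) = t - Int.fract t := by
          rw [natCast_floor_eq_intCast_floor ht0.le, Int.self_sub_fract]
        exact_mod_cast congrArg (fun x : ℝ ↦ (x : ℂ)) this
      rw [e2, e3]
      ring
    · exact integrableOn_Ioi_cpow_of_lt (by simpa using hs) one_pos
    · refine integrableOn_ofReal_mul_cpow measurable_fract <|
        (mem_integrableExpSet_mellinMeasure measurable_fract
        (fun t _ ↦ Int.fract_nonneg t) s.re).1 (Ioi_subset_integrableExpSet_fract ?_)
      exact lt_trans one_pos hs
  rw [hf, hz, hS, hInt]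
  field_simp

lemma riemannZeta₁_eq_of_re_pos {s : ℂ} (hs : 0 < s.re) :
    riemannZeta₁ s = s - s * (s - 1) * fractTransform s := by
  have hpre : IsPreconnected {z : ℂ | 0 < z.re} :=
    (convex_halfSpace_re_gt 0).isPreconnected
  have h1 : AnalyticOnNhd ℂ riemannZeta₁ {z : ℂ | 0 < z.re} :=
    fun z _ ↦ differentiable_riemannZeta₁.analyticAt z
  have h2 : AnalyticOnNhd ℂ (fun s ↦ s - s * (s - 1) * fractTransform s) {z : ℂ | 0 < z.re} := by
    intro z hz
    have := analyticAt_fractTransform hz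
    fun_prop
  refine h1.eqOn_of_preconnected_of_eventuallyEq h2 hpre (z₀ := 2) (by simp) ?_ hs
  have hopen : IsOpen {z : ℂ | 1 < z.re} := isOpen_lt continuous_const Complex.continuous_re
  filter_upwards [hopen.mem_nhds (show (2 : ℂ) ∈ {z : ℂ | 1 < z.re} by simp)] with z hz
  exact riemannZeta₁_eq_of_one_lt_re hz

lemma riemannZeta₁_ofReal_ne_zero {σ : ℝ} (h0 : 0 < σ) (h1 : σ ≤ 1) :
    riemannZeta₁ σ ≠ 0 := by
  rw [riemannZeta₁_eq_of_re_pos (by simpa using h0), fractTransform, complexMGF_ofReal]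
  have hm : 0 ≤ mgf (fun t ↦ -Real.log t) (mellinMeasure Int.fract) σ := mgf_nonneg
  generalize mgf (fun t ↦ -Real.log t) (mellinMeasure Int.fract) σ = m at hm
  norm_cast
  nlinarith [mul_nonneg (mul_nonneg h0.le (sub_nonneg.2 h1)) hm]

lemma norm_riemannZeta₁_le_of_half_le_re {s : ℂ} (hs : 1 / 2 ≤ s.re) :
    ‖riemannZeta₁ s‖ ≤ ‖s‖ + 2 * ‖s‖ * ‖s - 1‖ := by
  have hs0 : 0 < s.re := by linarith
  rw [riemannZeta₁_eq_of_re_pos hs0]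
  have hb : ‖fractTransform s‖ ≤ 2 := (norm_fractTransform_le hs0).trans (by
    rw [div_le_iff₀ hs0]; linarith)
  calc _ ≤ ‖s‖ + ‖s * (s - 1) * fractTransform s‖ := norm_sub_le _ _
    _ = ‖s‖ + ‖s‖ * ‖s - 1‖ * ‖fractTransform s‖ := by simp
    _ ≤ ‖s‖ + ‖s‖ * ‖s - 1‖ * 2 := by gcongr
    _ = _ := by ring

lemma riemannZeta₁_eq_sub_one_mul {s : ℂ} (hs : s ≠ 1) :
    riemannZeta₁ s = (s - 1) * riemannZeta s := by
  have := sub_ne_zero.2 hs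
  rw [riemannZeta_eq_inv_sub_mul hs]
  field_simp

lemma norm_Gamma_le_of_re_pos {w : ℂ} (hw : 0 < w.re) : ‖Complex.Gamma w‖ ≤ Real.Gamma w.re := by
  rw [Complex.Gamma_eq_integral hw, Real.Gamma_eq_integral hw, Complex.GammaIntegral]
  refine norm_integral_le_of_norm_le (Real.GammaIntegral_convergent hw) ?_
  filter_upwards [ae_restrict_mem measurableSet_Ioi] with t ht
  rw [norm_mul, Complex.norm_cpow_eq_rpow_re_of_pos ht, Complex.norm_real,
    Real.norm_of_nonneg (Real.exp_pos _).le]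
  simp

lemma Gamma_le_exp_rpow {x r : ℝ} (hx : 1 / 2 < x) (hxr : x ≤ r) (hr : 2 ≤ r) :
    Real.Gamma x ≤ 2 * Real.exp (6 * r ^ (3 / 2 : ℝ)) := by
  have hx0 : 0 < x := by linarith
  set n := ⌈x⌉₊ + 1 with hn
  have h1 : Real.Gamma x ≤ 2 * Real.Gamma (x + 2) := by
    rw [show x + 2 = (x + 1) + 1 by ring, Real.Gamma_add_one (by linarith),
      Real.Gamma_add_one hx0.ne']
    nlinarith [Real.Gamma_pos_of_pos hx0, mul_pos hx0 (Real.Gamma_pos_of_pos hx0)]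
  have h2 : Real.Gamma (x + 2) ≤ n.factorial := by
    rw [← Real.Gamma_nat_eq_factorial]
    refine Real.Gamma_strictMonoOn_Ici.monotoneOn ?_ ?_ ?_
    · simp only [Set.mem_Ici]; linarith
    · simp only [Set.mem_Ici, hn]; push_cast; linarith [Nat.le_ceil x]
    · rw [hn]; push_cast; linarith [Nat.le_ceil x]
  have hn2 : (n : ℝ) ≤ 2 * r := by
    rw [hn]; push_cast; linarith [Nat.ceil_lt_add_one hx0.le]
  have h3 : (n.factorial : ℝ) ≤ Real.exp (6 * r ^ (3 / 2 : ℝ)) := by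
    have hr0 : 0 < r := by linarith
    calc (n.factorial : ℝ) ≤ (n : ℝ) ^ n := by exact_mod_cast Nat.factorial_le_pow n
      _ ≤ (2 * r) ^ n := by gcongr
      _ = (2 * r) ^ (n : ℝ) := (Real.rpow_natCast _ _).symm
      _ ≤ (2 * r) ^ (2 * r) := Real.rpow_le_rpow_of_exponent_le (by linarith) hn2
      _ = Real.exp (Real.log (2 * r) * (2 * r)) := Real.rpow_def_of_pos (by linarith) _
      _ ≤ Real.exp (6 * r ^ (3 / 2 : ℝ)) := by
        rw [Real.exp_le_exp]
        have hsq : r ^ (3 / 2 : ℝ) = r * √r := by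
          rw [show (3 / 2 : ℝ) = 1 + 1 / 2 by norm_num, Real.rpow_add hr0, Real.rpow_one,
            Real.sqrt_eq_rpow]
        have hlog : Real.log (2 * r) ≤ 3 * √r := by
          have hs0 : 0 < √(2 * r) := Real.sqrt_pos.2 (by linarith)
          have : Real.log (2 * r) = 2 * Real.log √(2 * r) := by
            rw [Real.log_sqrt (by linarith)]; ring
          have h4 := Real.log_le_sub_one_of_pos hs0
          have h5 : √(2 * r) ≤ 3 / 2 * √r := by
            rw [Real.sqrt_mul (by norm_num)]
            have : √2 ≤ 3 / 2 := Real.sqrt_le_iff.2 ⟨by norm_num, by norm_num⟩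
            gcongr
          linarith
        rw [hsq]
        nlinarith
  linarith

lemma norm_cos_le_exp (z : ℂ) : ‖Complex.cos z‖ ≤ Real.exp ‖z‖ := by
  rw [Complex.cos, norm_div]
  have h1 : ‖Complex.exp (z * Complex.I)‖ ≤ Real.exp ‖z‖ := by
    rw [Complex.norm_exp, Real.exp_le_exp]
    simpa using Complex.re_le_norm (z * Complex.I)
  have h2 : ‖Complex.exp (-z * Complex.I)‖ ≤ Real.exp ‖z‖ := by
    rw [Complex.norm_exp, Real.exp_le_exp]
    simpa using Complex.re_le_norm (-z * Complex.I)
  have := norm_add_le (Complex.exp (z * Complex.I)) (Complex.exp (-z * Complex.I))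
  rw [div_le_iff₀ (by simp)]
  simp only [RCLike.norm_ofNat]
  linarith

/-- `(s - 1) * ζ s` is an entire function of order at most `3 / 2`. -/
lemma exists_riemannZeta₁_growth : ∃ C : ℝ, 0 < C ∧ ∀ z : ℂ, 1 ≤ ‖z‖ →
    ‖riemannZeta₁ (1 + z)‖ ≤ Real.exp (C * ‖z‖ ^ (3 / 2 : ℝ)) := by
  obtain ⟨M, hM⟩ := (isCompact_closedBall (0 : ℂ) 2).exists_bound_of_continuousOn
    (f := fun z ↦ riemannZeta₁ (1 + z))
    (differentiable_riemannZeta₁.continuous.comp (by fun_prop)).continuousOn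
  have hpow : ∀ r : ℝ, 1 ≤ r → r ≤ r ^ (3 / 2 : ℝ) := fun r hr ↦ by
    simpa using Real.rpow_le_rpow_of_exponent_le hr (show (1 : ℝ) ≤ 3 / 2 by norm_num)
  refine ⟨|M| + 20, by positivity, fun z hz ↦ ?_⟩
  set r := ‖z‖ with hr
  have hr0 : 0 < r := by linarith
  have hrp := hpow r hz
  rcases le_or_gt r 2 with h2 | h2
  · have h3 := hM z (by simpa using h2)
    calc _ ≤ |M| := h3.trans (le_abs_self M)
      _ ≤ Real.exp |M| := by linarith [Real.add_one_le_exp |M|]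
      _ ≤ _ := by
        rw [Real.exp_le_exp]
        nlinarith [abs_nonneg M]
  · have hexp2 : (6 : ℝ) ≤ Real.exp 2 := by
      have := Real.exp_one_gt_d9
      rw [show (2 : ℝ) = 1 + 1 by norm_num, Real.exp_add]
      nlinarith
    have hrexp : r ≤ Real.exp r := by linarith [Real.add_one_le_exp r]
    have hquad : 6 * r ^ 2 ≤ Real.exp (2 + 2 * r) := by
      rw [Real.exp_add, two_mul r, Real.exp_add]
      have : r ^ 2 ≤ Real.exp r * Real.exp r := by nlinarith
      gcongr
    have hbase : ∀ w : ℂ, ‖w‖ = r → ‖w‖ + 2 * ‖w‖ * ‖w - 1‖ ≤ 6 * r ^ 2 := fun w hw ↦ by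
      have : ‖w - 1‖ ≤ r + 1 := by
        have := norm_sub_le w 1
        rwa [hw, norm_one] at this
      rw [hw]
      nlinarith
    rcases le_or_gt (1 / 2) (1 + z).re with hre | hre
    · have h1 := norm_riemannZeta₁_le_of_half_le_re hre
      have h3 : ‖1 + z‖ ≤ 1 + r := by simpa using norm_add_le 1 z
      have h4 : ‖1 + z - 1‖ = r := by rw [add_sub_cancel_left]
      rw [h4] at h1
      calc _ ≤ 6 * r ^ 2 := by nlinarith
        _ ≤ Real.exp (2 + 2 * r) := hquad
        _ ≤ _ := by
          rw [Real.exp_le_exp]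
          nlinarith [abs_nonneg M]
    · set w := -z with hw
      have hwr : ‖w‖ = r := by rw [hw, norm_neg]
      have hwre : 1 / 2 < w.re := by
        simp only [Complex.add_re, Complex.one_re] at hre
        rw [hw, Complex.neg_re]; linarith
      have hwn : ∀ n : ℕ, w ≠ -n := fun n h ↦ by
        rw [h] at hwre
        simp only [Complex.neg_re, Complex.natCast_re] at hwre
        linarith [Nat.cast_nonneg (α := ℝ) n]
      have hw1 : w ≠ 1 := by rintro h; rw [h, norm_one] at hwr; linarith
      have hw1' : 1 ≤ ‖w - 1‖ := by
        have := norm_sub_norm_le w 1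
        rw [hwr, norm_one] at this; linarith
      have hz1 : 1 + z = 1 - w := by rw [hw]; ring
      have hne : 1 - w ≠ 1 := by
        intro h
        have : w = 0 := by linear_combination -h
        rw [this, norm_zero] at hwr; linarith
      have hzeta : ‖riemannZeta w‖ ≤ 6 * r ^ 2 := by
        have := norm_riemannZeta₁_le_of_half_le_re hwre.le
        rw [riemannZeta₁_eq_sub_one_mul hw1, norm_mul] at this
        nlinarith [norm_nonneg (riemannZeta w), hbase w hwr]
      have hcos : ‖Complex.cos (Real.pi * w / 2)‖ ≤ Real.exp (2 * r) := by
        refine (norm_cos_le_exp _).trans ?_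
        rw [Real.exp_le_exp, norm_div, norm_mul, hwr, Complex.norm_real,
          Real.norm_of_nonneg Real.pi_pos.le]
        simp only [RCLike.norm_ofNat]
        nlinarith [Real.pi_le_four]
      have hpi : ‖(2 * Real.pi : ℂ) ^ (-w)‖ ≤ 1 := by
        rw [show (2 * Real.pi : ℂ) = ((2 * Real.pi : ℝ) : ℂ) by push_cast; rfl,
          Complex.norm_cpow_eq_rpow_re_of_pos (by positivity)]
        refine Real.rpow_le_one_of_one_le_of_nonpos ?_ ?_
        · linarith [Real.pi_gt_three]
        · rw [Complex.neg_re]; linarith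
      have hGam : ‖Complex.Gamma w‖ ≤ 2 * Real.exp (6 * r ^ (3 / 2 : ℝ)) :=
        (norm_Gamma_le_of_re_pos (by linarith)).trans
          (Gamma_le_exp_rpow hwre (hwr ▸ Complex.re_le_norm w) h2.le)
      rw [hz1, riemannZeta₁_eq_sub_one_mul hne, riemannZeta_one_sub hwn hw1]
      simp only [norm_mul, RCLike.norm_ofNat, show 1 - w - 1 = -w by ring, norm_neg, hwr]
      calc _ ≤ r * (2 * 1 * (2 * Real.exp (6 * r ^ (3 / 2 : ℝ))) * Real.exp (2 * r) *
            (6 * r ^ 2)) := by gcongr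
        _ ≤ Real.exp r * (Real.exp 2 * Real.exp (6 * r ^ (3 / 2 : ℝ)) * Real.exp (2 * r) *
            Real.exp (2 + 2 * r)) := by
          rw [show 2 * 1 * (2 * Real.exp (6 * r ^ (3 / 2 : ℝ))) =
            4 * Real.exp (6 * r ^ (3 / 2 : ℝ)) by ring]
          gcongr
          linarith
        _ ≤ _ := by
          simp only [← Real.exp_add]
          rw [Real.exp_le_exp]
          nlinarith [abs_nonneg M]

/-- Partial fractions for `f' / f`, where `f s = (s - 1) * ζ s`, normalised at `s = 1`. -/
lemma hasSum_logDeriv_riemannZeta₁ {w : ℂ} (hw : riemannZeta₁ w ≠ 0) :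
    HasSum (fun ρ : ℂ ↦ (analyticOrderNatAt riemannZeta₁ ρ : ℂ) * (1 / (w - ρ) - 1 / (1 - ρ)))
      (logDeriv riemannZeta₁ w - logDeriv riemannZeta₁ 1) := by
  obtain ⟨C, hC, hgrowth⟩ := exists_riemannZeta₁_growth
  set g : ℂ → ℂ := fun z ↦ riemannZeta₁ (1 + z) with hg
  have hgd : Differentiable ℂ g := differentiable_riemannZeta₁.comp (by fun_prop)
  have hlog : ∀ z, logDeriv g z = logDeriv riemannZeta₁ (1 + z) := fun z ↦ by
    rw [logDeriv_apply, logDeriv_apply, hg, deriv_comp_const_add]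
  have hord : ∀ ρ, analyticOrderNatAt g (ρ - 1) = analyticOrderNatAt riemannZeta₁ ρ := fun ρ ↦ by
    have h := analyticOrderAt_comp_of_deriv_ne_zero (f := riemannZeta₁) (g := fun z : ℂ ↦ 1 + z)
      (z₀ := ρ - 1) (by fun_prop) (by simp)
    rw [analyticOrderNatAt, analyticOrderNatAt]
    congr 1
    rw [show g = riemannZeta₁ ∘ fun z ↦ 1 + z from rfl, h, add_sub_cancel]
  have hsum := hasSum_logDeriv_sub hgd (by simp [hg]) hC hgrowth (w := w - 1)
    (by simpa [hg] using hw)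
  rw [hlog, hlog, add_sub_cancel, add_zero] at hsum
  rw [← (Equiv.subRight (1 : ℂ)).hasSum_iff] at hsum
  convert hsum using 1
  funext ρ
  simp only [Function.comp_apply, Equiv.subRight_apply, hord]
  rw [show w - 1 - (ρ - 1) = w - ρ by ring, ← neg_sub 1 ρ, one_div_neg_eq_neg_one_div,
    sub_eq_add_neg]

lemma riemannZeta₁_ne_zero_of_one_le_re {s : ℂ} (hs : 1 ≤ s.re) : riemannZeta₁ s ≠ 0 := by
  rcases eq_or_ne s 1 with rfl | h1
  · simp
  · rw [riemannZeta₁_eq_sub_one_mul h1]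
    exact mul_ne_zero (sub_ne_zero.2 h1) (riemannZeta_ne_zero_of_one_le_re hs)

lemma riemannZeta₁_neg_two_mul_nat_add_one (n : ℕ) : riemannZeta₁ (-2 * (n + 1)) = 0 := by
  rw [riemannZeta₁_eq_sub_one_mul, riemannZeta_neg_two_mul_nat_add_one, mul_zero]
  intro h
  have := congrArg Complex.re h
  simp at this
  linarith [Nat.cast_nonneg (α := ℝ) n]

/-- If `ζ` has no zeros to the right of the critical line, then every zero is on the critical
line or trivial. -/
lemma re_eq_half_or_trivial (hRH : ∀ s : ℂ, 1 / 2 < s.re → riemannZeta₁ s ≠ 0) {ρ : ℂ}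
    (hρ : riemannZeta₁ ρ = 0) : ρ.re = 1 / 2 ∨ ∃ n : ℕ, ρ = -2 * (n + 1) := by
  rcases lt_trichotomy ρ.re (1 / 2) with hlt | heq | hgt
  · right
    set w := 1 - ρ with hw
    have hwre : 1 / 2 < w.re := by rw [hw, Complex.sub_re, Complex.one_re]; linarith
    have hwn : ∀ n : ℕ, w ≠ -n := fun n h ↦ by
      rw [h] at hwre
      simp only [Complex.neg_re, Complex.natCast_re] at hwre
      linarith [Nat.cast_nonneg (α := ℝ) n]
    have hρw : ρ = 1 - w := by rw [hw]; ring
    have hρ1 : ρ ≠ 1 := by rintro rfl; simp at hρ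
    rw [riemannZeta₁_eq_sub_one_mul hρ1] at hρ
    have hζ := (mul_eq_zero.1 hρ).resolve_left (sub_ne_zero.2 hρ1)
    have hw1 : w ≠ 1 := by
      intro h
      rw [hρw, h, sub_self, riemannZeta_zero] at hζ
      norm_num at hζ
    have hζw : riemannZeta w ≠ 0 := fun h ↦ hRH w hwre (by
      rw [riemannZeta₁_eq_sub_one_mul hw1, h, mul_zero])
    rw [hρw, riemannZeta_one_sub hwn hw1] at hζ
    have hpi : (2 * Real.pi : ℂ) ^ (-w) ≠ 0 := by
      rw [Complex.cpow_ne_zero_iff]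
      left
      simp [Real.pi_ne_zero]
    have hcos : Complex.cos (Real.pi * w / 2) = 0 := by
      simpa [hpi, hζw, Complex.Gamma_ne_zero_of_re_pos (show 0 < w.re by linarith)] using hζ
    obtain ⟨k, hk⟩ := Complex.cos_eq_zero_iff.1 hcos
    have hwk : w = 2 * k + 1 := by
      have : (Real.pi : ℂ) ≠ 0 := by simp [Real.pi_ne_zero]
      field_simp at hk
      exact hk
    have hkpos : 1 ≤ k := by
      by_contra hcon
      have hk0 : k ≤ 0 := by omega
      rcases hk0.lt_or_eq with h | h
      · have hkr : (k : ℝ) ≤ -1 := by exact_mod_cast (show k ≤ -1 by omega)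
        rw [hwk] at hwre
        simp at hwre
        linarith
      · exact hw1 (by rw [hwk, h]; simp)
    refine ⟨(k - 1).toNat, ?_⟩
    have : (((k - 1).toNat : ℤ) : ℂ) = ((k - 1 : ℤ) : ℂ) := by
      rw [Int.toNat_of_nonneg (by omega)]
    rw [Int.cast_natCast] at this
    rw [hρw, hwk, this]
    push_cast
    ring
  · exact Or.inl heq
  · exact absurd hρ (hRH ρ hgt)

lemma analyticOrderAt_riemannZeta₁_ne_top (ρ : ℂ) : analyticOrderAt riemannZeta₁ ρ ≠ ⊤ :=
  analyticOrderAt_ne_top_of_differentiable differentiable_riemannZeta₁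
    (z₀ := 1) (by simp) ρ

lemma one_le_analyticOrderNatAt_of_zero {ρ : ℂ} (hρ : riemannZeta₁ ρ = 0) :
    1 ≤ analyticOrderNatAt riemannZeta₁ ρ := by
  rw [Nat.one_le_iff_ne_zero]
  intro h
  have h1 : analyticOrderAt riemannZeta₁ ρ = 0 := by
    rw [← Nat.cast_analyticOrderNatAt (analyticOrderAt_riemannZeta₁_ne_top ρ), h, Nat.cast_zero]
  exact (differentiable_riemannZeta₁.analyticAt ρ).analyticOrderAt_eq_zero.1 h1 hρ

/-- The logarithmic derivative has residue `m` at a zero of order `m`. -/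
lemma tendsto_sub_mul_logDeriv {f : ℂ → ℂ} (hf : Differentiable ℂ f) {ρ : ℂ}
    (hord : analyticOrderAt f ρ ≠ ⊤) :
    Tendsto (fun z ↦ (z - ρ) * logDeriv f z) (𝓝[≠] ρ) (𝓝 (analyticOrderNatAt f ρ : ℂ)) := by
  obtain ⟨g, hg, hgρ, hfg⟩ := exists_differentiable_eq_pow_mul hf hord
  set n := analyticOrderNatAt f ρ
  have hlim : Tendsto (fun z ↦ (n : ℂ) + (z - ρ) * logDeriv g z) (𝓝[≠] ρ) (𝓝 n) := by
    have hc : ContinuousAt (fun z ↦ (n : ℂ) + (z - ρ) * (deriv g z / g z)) ρ := by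
      have h1 : ContinuousAt (deriv g) ρ := (hg.analyticAt ρ).deriv.continuousAt
      have h2 : ContinuousAt g ρ := hg.continuous.continuousAt
      exact continuousAt_const.add ((by fun_prop : ContinuousAt (fun z ↦ z - ρ) ρ).mul
        (h1.div h2 hgρ))
    have := hc.tendsto.mono_left (nhdsWithin_le_nhds (s := {ρ}ᶜ))
    simpa [logDeriv_apply] using this
  refine hlim.congr' ?_
  have hne : ∀ᶠ z in 𝓝[≠] ρ, g z ≠ 0 :=
    nhdsWithin_le_nhds (hg.continuous.continuousAt.eventually_ne hgρ)
  filter_upwards [hne, self_mem_nhdsWithin] with z hz hzρ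
  have hzρ' : z - ρ ≠ 0 := sub_ne_zero.2 hzρ
  have : f = fun z ↦ (z - ρ) ^ n * g z := funext hfg
  rw [this, logDeriv_mul (f := fun z ↦ (z - ρ) ^ n) z (pow_ne_zero _ hzρ') hz (by fun_prop) (hg z),
    logDeriv_fun_pow (by fun_prop), logDeriv_apply (fun z ↦ z - ρ)]
  simp only [deriv_sub_const, deriv_id'']
  field_simp

/-- The term `∑_{j ≥ k} log p * p ^ (-j w)`. -/
noncomputable def primeTailTerm (k : ℕ) (w : ℂ) (p : Nat.Primes) : ℂ :=
  (Real.log (p : ℕ) : ℂ) * (((p : ℕ) : ℂ) ^ (-w)) ^ k / (1 - ((p : ℕ) : ℂ) ^ (-w))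

/-- The sum `∑_p ∑_{j ≥ k} log p * p ^ (-j w)`. -/
noncomputable def primeTail (k : ℕ) (w : ℂ) : ℂ := ∑' p : Nat.Primes, primeTailTerm k w p

/-- The sum `∑_p log p * p ^ (-w)`. -/
noncomputable def primeLogSum (w : ℂ) : ℂ :=
  ∑' p : Nat.Primes, (Real.log (p : ℕ) : ℂ) * ((p : ℕ) : ℂ) ^ (-w)

lemma summable_primes_log_mul_rpow {a : ℝ} (ha : 1 < a) :
    Summable fun p : Nat.Primes ↦ Real.log (p : ℕ) * ((p : ℕ) : ℝ) ^ (-a) := by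
  set e := (a - 1) / 2 with he
  have he0 : 0 < e := by rw [he]; linarith
  have hs : Summable fun p : Nat.Primes ↦ e⁻¹ * ((p : ℕ) : ℝ) ^ (e - a) :=
    (Nat.Primes.summable_rpow.2 (by rw [he]; linarith)).mul_left _
  refine Summable.of_nonneg_of_le (fun p ↦ ?_) (fun p ↦ ?_) hs
  · exact mul_nonneg (Real.log_natCast_nonneg _) (by positivity)
  · have hp : (0 : ℝ) < (p : ℕ) := by exact_mod_cast p.2.pos
    rw [sub_eq_add_neg, Real.rpow_add hp, ← mul_assoc]
    gcongr
    have := Real.log_le_rpow_div hp.le he0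
    rwa [div_eq_inv_mul] at this

lemma norm_prime_cpow_neg (p : Nat.Primes) (w : ℂ) :
    ‖((p : ℕ) : ℂ) ^ (-w)‖ = ((p : ℕ) : ℝ) ^ (-w.re) := by
  rw [Complex.norm_natCast_cpow_of_pos p.2.pos, Complex.neg_re]

lemma prime_rpow_neg_le {σ : ℝ} (hσ : 0 < σ) (p : Nat.Primes) {w : ℂ} (hw : σ ≤ w.re) :
    ((p : ℕ) : ℝ) ^ (-w.re) ≤ 2 ^ (-σ) := by
  have hp : (2 : ℝ) ≤ (p : ℕ) := by exact_mod_cast p.2.two_le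
  calc ((p : ℕ) : ℝ) ^ (-w.re) ≤ ((p : ℕ) : ℝ) ^ (-σ) :=
        Real.rpow_le_rpow_of_exponent_le (by linarith) (by linarith)
    _ ≤ 2 ^ (-σ) := Real.rpow_le_rpow_of_nonpos (by norm_num) hp (by linarith)

lemma two_rpow_neg_lt_one {σ : ℝ} (hσ : 0 < σ) : (2 : ℝ) ^ (-σ) < 1 :=
  Real.rpow_lt_one_of_one_lt_of_neg (by norm_num) (by linarith)

lemma one_sub_prime_cpow_ne_zero {w : ℂ} (hw : 0 < w.re) (p : Nat.Primes) :
    1 - ((p : ℕ) : ℂ) ^ (-w) ≠ 0 := by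
  intro h
  have h1 : ‖((p : ℕ) : ℂ) ^ (-w)‖ = 1 := by rw [← sub_eq_zero.1 h, norm_one]
  rw [norm_prime_cpow_neg] at h1
  linarith [prime_rpow_neg_le hw p le_rfl, two_rpow_neg_lt_one hw]

lemma norm_primeTailTerm_le (k : ℕ) {σ : ℝ} (hσ : 0 < σ) {w : ℂ} (hw : σ ≤ w.re)
    (p : Nat.Primes) : ‖primeTailTerm k w p‖ ≤
      (1 - 2 ^ (-σ))⁻¹ * (Real.log (p : ℕ) * ((p : ℕ) : ℝ) ^ (-(k * σ))) := by
  have hp : (1 : ℝ) ≤ (p : ℕ) := by exact_mod_cast p.2.one_le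
  have h2 := two_rpow_neg_lt_one hσ
  have hlog : 0 ≤ Real.log (p : ℕ) := Real.log_natCast_nonneg _
  have hden : 1 - (2 : ℝ) ^ (-σ) ≤ ‖1 - ((p : ℕ) : ℂ) ^ (-w)‖ := by
    have h3 := norm_sub_norm_le 1 (((p : ℕ) : ℂ) ^ (-w))
    rw [norm_one, norm_prime_cpow_neg] at h3
    linarith [prime_rpow_neg_le hσ p hw]
  have hnum : (((p : ℕ) : ℝ) ^ (-w.re)) ^ k ≤ ((p : ℕ) : ℝ) ^ (-(k * σ)) := by
    rw [← Real.rpow_natCast, ← Real.rpow_mul (by positivity)]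
    refine Real.rpow_le_rpow_of_exponent_le hp ?_
    have : (0 : ℝ) ≤ k := Nat.cast_nonneg k
    nlinarith
  rw [primeTailTerm, norm_div, norm_mul, norm_pow, norm_prime_cpow_neg, Complex.norm_real,
    Real.norm_of_nonneg hlog, div_eq_inv_mul]
  have hpos : 0 < 1 - (2 : ℝ) ^ (-σ) := by linarith
  gcongr

lemma summable_primeTailTerm {k : ℕ} {w : ℂ} (hw : 1 < k * w.re) :
    Summable (primeTailTerm k w) := by
  have hk : (0 : ℝ) ≤ k := Nat.cast_nonneg k
  have hw0 : 0 < w.re := by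
    by_contra h
    nlinarith [not_lt.1 h]
  exact Summable.of_norm_bounded ((summable_primes_log_mul_rpow hw).mul_left _)
    (norm_primeTailTerm_le k hw0 le_rfl)

lemma analyticAt_primeTail {k : ℕ} {w : ℂ} (hw : 1 < k * w.re) : AnalyticAt ℂ (primeTail k) w := by
  have hk : (0 : ℝ) < k := by
    rcases Nat.eq_zero_or_pos k with rfl | h
    · norm_num at hw
    · exact_mod_cast h
  obtain ⟨σ, hσ1, hσ2⟩ := exists_between (show 1 / (k : ℝ) < w.re by
    rw [div_lt_iff₀ hk]; linarith)
  have hσ0 : 0 < σ := lt_trans (by positivity) hσ1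
  have hopen : IsOpen {z : ℂ | σ < z.re} := isOpen_lt continuous_const Complex.continuous_re
  have hd : DifferentiableOn ℂ (fun w ↦ ∑' p : Nat.Primes, primeTailTerm k w p)
      {z : ℂ | σ < z.re} := by
    refine Complex.differentiableOn_tsum_of_summable_norm
      (u := fun p : Nat.Primes ↦
        (1 - 2 ^ (-σ))⁻¹ * (Real.log (p : ℕ) * ((p : ℕ) : ℝ) ^ (-(k * σ))))
      ?_ (fun p z hz ↦ ?_) hopen (fun p z hz ↦ norm_primeTailTerm_le k hσ0 (le_of_lt hz) p)
    · refine (summable_primes_log_mul_rpow ?_).mul_left _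
      rw [div_lt_iff₀ hk] at hσ1; linarith
    · have hp : ((p : ℕ) : ℂ) ≠ 0 := by exact_mod_cast p.2.ne_zero
      have hz0 : 0 < z.re := lt_trans hσ0 hz
      have h1 : DifferentiableAt ℂ (fun z : ℂ ↦ ((p : ℕ) : ℂ) ^ (-z)) z :=
        (differentiableAt_id.neg).const_cpow (Or.inl hp)
      have : DifferentiableAt ℂ (fun z ↦ primeTailTerm k z p) z := by
        unfold primeTailTerm
        exact ((h1.pow k).const_mul _).div (h1.const_sub 1) (one_sub_prime_cpow_ne_zero hz0 p)
      exact this.differentiableWithinAt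
  exact hd.analyticAt (hopen.mem_nhds hσ2)

lemma primeTailTerm_sub_succ (k : ℕ) {w : ℂ} (hw : 0 < w.re) (p : Nat.Primes) :
    primeTailTerm k w p - primeTailTerm (k + 1) w p =
      (Real.log (p : ℕ) : ℂ) * (((p : ℕ) : ℂ) ^ (-w)) ^ k := by
  have := one_sub_prime_cpow_ne_zero hw p
  rw [primeTailTerm, primeTailTerm, pow_succ]
  field_simp

lemma primeTail_sub_succ {k : ℕ} {w : ℂ} (hw : 1 < k * w.re) :
    primeTail k w - primeTail (k + 1) w = primeLogSum (k * w) := by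
  have hk : (0 : ℝ) ≤ k := Nat.cast_nonneg k
  have hw0 : 0 < w.re := by
    by_contra h
    nlinarith [not_lt.1 h]
  rw [primeTail, primeTail, ← (summable_primeTailTerm hw).tsum_sub
    (summable_primeTailTerm (by push_cast; linarith)), primeLogSum]
  refine tsum_congr fun p ↦ ?_
  rw [primeTailTerm_sub_succ k hw0, ← Complex.cpow_nat_mul, mul_neg]

lemma primeTail_one_eq {w : ℂ} (hw : 1 < w.re) :
    primeTail 1 w = -deriv riemannZeta w / riemannZeta w := by
  rw [← ArithmeticFunction.LSeries_vonMangoldt_eq_deriv_riemannZeta_div hw, LSeries,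
    tsum_eq_tsum_primes_of_support_subset_prime_powers
      (ArithmeticFunction.LSeriesSummable_vonMangoldt hw), primeTail]
  · refine tsum_congr fun p ↦ ?_
    have hp : (p : ℕ) ≠ 0 := p.2.ne_zero
    have hlt : ‖((p : ℕ) : ℂ) ^ (-w)‖ < 1 := by
      rw [norm_prime_cpow_neg]
      have hw0 : 0 < w.re := by linarith
      exact (prime_rpow_neg_le hw0 p le_rfl).trans_lt (two_rpow_neg_lt_one hw0)
    have hterm : ∀ k : ℕ, LSeries.term (fun n ↦ (ArithmeticFunction.vonMangoldt n : ℂ)) w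
        ((p : ℕ) ^ (k + 1)) =
        (Real.log (p : ℕ) : ℂ) * ((p : ℕ) : ℂ) ^ (-w) * (((p : ℕ) : ℂ) ^ (-w)) ^ k := fun k ↦ by
      rw [LSeries.term_of_ne_zero (pow_ne_zero _ hp),
        ArithmeticFunction.vonMangoldt_apply_pow (Nat.succ_ne_zero k),
        ArithmeticFunction.vonMangoldt_apply_prime p.2, mul_assoc, ← pow_succ',
        ← Complex.cpow_nat_mul, div_eq_mul_inv, ← Complex.cpow_neg, Nat.cast_pow,
        ← Complex.natCast_cpow_natCast_mul, mul_comm, mul_neg]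
    simp_rw [hterm]
    rw [tsum_mul_left, tsum_geometric_of_norm_lt_one hlt, primeTailTerm, pow_one, div_eq_mul_inv]
  · intro n hn
    rw [Function.mem_support] at hn
    by_contra hcon
    have hΛ := ArithmeticFunction.vonMangoldt_eq_zero_iff.2 hcon
    exact hn (by simp [LSeries.term, hΛ])

lemma logDeriv_riemannZeta₁_eq {w : ℂ} (hw : 1 < w.re) :
    logDeriv riemannZeta₁ w = 1 / (w - 1) - primeTail 1 w := by
  have hw1 : w ≠ 1 := by rintro rfl; simp at hw
  have hw1' : w - 1 ≠ 0 := sub_ne_zero.2 hw1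
  have heq : riemannZeta₁ =ᶠ[𝓝 w] fun s ↦ (s - 1) * riemannZeta s := by
    filter_upwards [isOpen_ne.mem_nhds hw1] with s hs using riemannZeta₁_eq_sub_one_mul hs
  have hζ : riemannZeta w ≠ 0 := riemannZeta_ne_zero_of_one_le_re hw.le
  rw [primeTail_one_eq hw, logDeriv_apply, heq.deriv_eq, heq.self_of_nhds, ← logDeriv_apply
    (fun s ↦ (s - 1) * riemannZeta s), logDeriv_mul (f := fun s : ℂ ↦ s - 1) w hw1' hζ (by fun_prop)
    (differentiableAt_riemannZeta hw1), logDeriv_apply, logDeriv_apply]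
  simp only [deriv_sub_const, deriv_id'']
  ring

lemma primeTail_two_one : primeTail 2 1 =
    ((∑' p : Nat.Primes, Real.log (p : ℕ) / (((p : ℕ) : ℝ) * (((p : ℕ) : ℝ) - 1)) : ℝ) : ℂ) := by
  rw [primeTail, Complex.ofReal_tsum]
  refine tsum_congr fun p ↦ ?_
  have hp : ((p : ℕ) : ℂ) ≠ 0 := by exact_mod_cast p.2.ne_zero
  have hp1 : ((p : ℕ) : ℂ) - 1 ≠ 0 := sub_ne_zero.2 (by exact_mod_cast p.2.one_lt.ne')
  have hp2 : 1 - (((p : ℕ) : ℂ))⁻¹ ≠ 0 := by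
    have := one_sub_prime_cpow_ne_zero (w := 1) (by simp) p
    rwa [Complex.cpow_neg_one] at this
  rw [primeTailTerm, Complex.cpow_neg_one]
  push_cast
  field_simp

lemma mertensE_eq : (mertensE : ℂ) = -logDeriv riemannZeta₁ 1 - primeTail 2 1 := by
  rw [mertensE, primeTail_two_one, logDeriv_apply, deriv_riemannZeta₁_one, riemannZeta₁_one]
  push_cast
  ring

/-- **Landau's lemma**: the abscissa of convergence of the Laplace transform of a positive measure
is a singularity of the transform. -/
lemma exists_sub_mem_integrableExpSet {Ω : Type*} {mΩ : MeasurableSpace Ω} {μ : Measure Ω}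
    {X : Ω → ℝ} (hXm : Measurable X) (hX : ∀ᵐ ω ∂μ, X ω ≤ 0) {b : ℝ}
    (hb : Set.Ioi b ⊆ integrableExpSet X μ) {g : ℂ → ℂ} (hg : AnalyticAt ℂ g b)
    (heq : ∀ᶠ s in 𝓝 (b : ℂ), b < s.re → g s = complexMGF X μ s) :
    ∃ ε > 0, b - ε ∈ integrableExpSet X μ := by
  obtain ⟨r, hr, hball⟩ := Metric.eventually_nhds_iff_ball.1 (hg.eventually_analyticAt.and heq)
  set c : ℝ := b + r / 4 with hc
  have hdist : dist (c : ℂ) b = r / 4 := by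
    rw [Complex.dist_of_im_eq (by simp), Complex.ofReal_re, Complex.ofReal_re, Real.dist_eq, hc,
      add_sub_cancel_left, abs_of_pos (by positivity)]
  have hsub : ball (c : ℂ) (3 * r / 4) ⊆ ball (b : ℂ) r :=
    ball_subset_ball' (by rw [hdist]; linarith)
  have hcint : (c : ℂ).re ∈ interior (integrableExpSet X μ) :=
    interior_mono hb (by rw [interior_Ioi, Complex.ofReal_re]; exact Set.mem_Ioi.2 (by linarith))
  have hgd : DifferentiableOn ℂ g (ball (c : ℂ) (3 * r / 4)) := fun z hz ↦
    (hball z (hsub hz)).1.differentiableAt.differentiableWithinAt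
  have hz : ((b - r / 4 : ℝ) : ℂ) ∈ ball (c : ℂ) (3 * r / 4) := by
    rw [mem_ball, Complex.dist_of_im_eq (by simp), Complex.ofReal_re, Complex.ofReal_re,
      Real.dist_eq, hc, abs_lt]
    constructor <;> linarith
  have hev : g =ᶠ[𝓝 (c : ℂ)] complexMGF X μ := by
    have h1 : ∀ᶠ s in 𝓝 (c : ℂ), b < s.re :=
      (isOpen_lt continuous_const Complex.continuous_re).mem_nhds
        (by change b < (c : ℂ).re; rw [Complex.ofReal_re]; linarith)
    filter_upwards [h1, isOpen_ball.mem_nhds (hsub (mem_ball_self (by positivity)))] with s h1 h2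
    exact (hball s h2).2 h1
  have hsum := Complex.hasSum_taylorSeries_on_ball hgd hz
  have hterm (n : ℕ) : (n.factorial : ℂ)⁻¹ • (((b - r / 4 : ℝ) : ℂ) - c) ^ n • iteratedDeriv n g c
      = ((∫ ω, ((-(r / 2)) * X ω) ^ n / n.factorial * Real.exp (c * X ω) ∂μ : ℝ) : ℂ) := by
    rw [hev.iteratedDeriv_eq, iteratedDeriv_complexMGF hcint, ← integral_complex_ofReal,
      smul_smul, smul_eq_mul, ← integral_const_mul]
    congr 1 with ω
    push_cast
    rw [hc]
    push_cast
    ring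
  simp_rw [hterm] at hsum
  have hsumR : Summable fun n : ℕ ↦
      ∫ ω, ((-(r / 2)) * X ω) ^ n / n.factorial * Real.exp (c * X ω) ∂μ :=
    Complex.summable_ofReal.1 hsum.summable
  have hInt (n : ℕ) :
      Integrable (fun ω ↦ ((-(r / 2)) * X ω) ^ n / n.factorial * Real.exp (c * X ω)) μ := by
    have := (integrable_pow_mul_exp_of_mem_interior_integrableExpSet hcint n).const_mul
      ((-(r / 2)) ^ n / n.factorial)
    refine this.congr (Eventually.of_forall fun ω ↦ ?_)
    simp only [Complex.ofReal_re]
    ring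
  have hnn (n : ℕ) :
      0 ≤ᵐ[μ] fun ω ↦ ((-(r / 2)) * X ω) ^ n / n.factorial * Real.exp (c * X ω) := by
    filter_upwards [hX] with ω hω
    have : 0 ≤ -(r / 2) * X ω := mul_nonneg_of_nonpos_of_nonpos (by linarith) hω
    positivity
  refine ⟨r / 4, by positivity, ?_⟩
  change Integrable (fun ω ↦ Real.exp ((b - r / 4) * X ω)) μ
  refine ⟨by fun_prop, ?_⟩
  rw [hasFiniteIntegral_iff_ofReal (Eventually.of_forall fun _ ↦ (Real.exp_pos _).le)]
  have hexp : ∀ᵐ ω ∂μ, ENNReal.ofReal (Real.exp ((b - r / 4) * X ω)) =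
      ∑' n : ℕ, ENNReal.ofReal (((-(r / 2)) * X ω) ^ n / n.factorial * Real.exp (c * X ω)) := by
    filter_upwards [ae_all_iff.2 hnn] with ω hω
    have hs := (NormedSpace.expSeries_div_hasSum_exp (𝔸 := ℝ) (-(r / 2) * X ω)).mul_right (Real.exp (c * X ω))
    rw [← ENNReal.ofReal_tsum_of_nonneg hω hs.summable, hs.tsum_eq, ← Real.exp_eq_exp_ℝ, ← Real.exp_add, hc]
    ring_nf
  rw [lintegral_congr_ae hexp, lintegral_tsum (fun n ↦ by fun_prop)]
  simp_rw [← ofReal_integral_eq_lintegral_ofReal (hInt _) (hnn _)]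
  rw [← ENNReal.ofReal_tsum_of_nonneg (fun n ↦ integral_nonneg_of_ae (hnn n)) hsumR]
  exact ENNReal.ofReal_lt_top

/-- The coefficient `log p / p` supported on the primes. -/
noncomputable def primeCoeff (n : ℕ) : ℝ := if n.Prime then Real.log n / n else 0

lemma primeCoeff_nonneg (n : ℕ) : 0 ≤ primeCoeff n := by
  unfold primeCoeff
  split_ifs
  · positivity
  · exact le_rfl

lemma mertensDelta_eq (x : ℝ) : mertensDelta x =
    ∑ k ∈ Finset.Icc 1 ⌊x⌋₊, primeCoeff k - Real.log x - mertensE := by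
  rw [mertensDelta, Finset.sum_filter, ← sub_sub]
  congr 2
  refine (Finset.sum_subset (fun k hk ↦ ?_) fun k hk hk' ↦ ?_).symm
  · simp only [Finset.mem_Icc, Finset.mem_range] at *
    omega
  · have : k = 0 := by
      simp only [Finset.mem_Icc, Finset.mem_range] at *
      omega
    simp [this]

lemma sum_primeCoeff_le {r : ℝ} (hr : 0 < r) {n : ℕ} (hn : 1 ≤ n) :
    ∑ k ∈ Finset.Icc 1 n, primeCoeff k ≤ (2 / r) * (1 + 2 / r) * (n : ℝ) ^ r := by
  have hn' : (1 : ℝ) ≤ n := by exact_mod_cast hn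
  have h1 : ∑ k ∈ Finset.Icc 1 n, primeCoeff k ≤ Real.log n * (1 + Real.log n) := by
    calc ∑ k ∈ Finset.Icc 1 n, primeCoeff k
        ≤ ∑ k ∈ Finset.Icc 1 n, Real.log n * (k : ℝ)⁻¹ := by
          refine Finset.sum_le_sum fun k hk ↦ ?_
          rw [Finset.mem_Icc] at hk
          have hk1 : (0 : ℝ) < k := by exact_mod_cast hk.1
          unfold primeCoeff
          split_ifs
          · rw [div_eq_mul_inv]
            gcongr
            exact hk.2
          · have := Real.log_nonneg hn'
            positivity
      _ = Real.log n * (harmonic n : ℝ) := by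
          rw [← Finset.mul_sum, harmonic_eq_sum_Icc]
          push_cast
          rfl
      _ ≤ _ := by
          gcongr
          exact harmonic_le_one_add_log n
  have h2 : Real.log n ≤ (n : ℝ) ^ (r / 2) * (2 / r) := by
    have := Real.log_le_rpow_div (x := n) (by positivity) (half_pos hr)
    rwa [div_eq_mul_inv _ (r / 2), inv_div] at this
  have h3 : 1 ≤ (n : ℝ) ^ (r / 2) := Real.one_le_rpow hn' (by positivity)
  have h4 : (n : ℝ) ^ r = (n : ℝ) ^ (r / 2) * (n : ℝ) ^ (r / 2) := by
    rw [← Real.rpow_add (by positivity), add_halves]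
  have h5 := Real.log_nonneg hn'
  calc _ ≤ _ := h1
    _ ≤ (n : ℝ) ^ (r / 2) * (2 / r) * ((n : ℝ) ^ (r / 2) + (n : ℝ) ^ (r / 2) * (2 / r)) := by
        gcongr
    _ = _ := by rw [h4]; ring

lemma measurable_sum_primeCoeff : Measurable fun x : ℝ ↦ ∑ k ∈ Finset.Icc 1 ⌊x⌋₊, primeCoeff k :=
  (measurable_from_nat (f := fun n ↦ ∑ k ∈ Finset.Icc 1 n, primeCoeff k)).comp Nat.measurable_floor

lemma measurable_mertensDelta : Measurable mertensDelta := by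
  rw [funext mertensDelta_eq]
  exact (measurable_sum_primeCoeff.sub Real.measurable_log).sub_const _

lemma integrableOn_mul_rpow_of_le {G : ℝ → ℝ} (hG : Measurable G) {C r a : ℝ}
    (hGr : ∀ t, 1 < t → |G t| ≤ C * t ^ r) (ha : r < a) :
    IntegrableOn (fun t ↦ G t * t ^ (-(a + 1))) (Set.Ioi 1) := by
  have h : IntegrableOn (fun t : ℝ ↦ C * t ^ (r - a - 1)) (Set.Ioi 1) :=
    (integrableOn_Ioi_rpow_of_lt (by linarith) one_pos).const_mul C
  refine Integrable.mono' h (by fun_prop) ?_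
  filter_upwards [ae_restrict_mem measurableSet_Ioi] with t ht
  have ht0 : 0 < t := lt_trans one_pos ht
  rw [norm_mul, Real.norm_eq_abs, Real.norm_of_nonneg (Real.rpow_nonneg ht0.le _),
    show r - a - 1 = r + -(a + 1) by ring, Real.rpow_add ht0, ← mul_assoc]
  gcongr
  exact hGr t ht

lemma integrableOn_sum_primeCoeff_mul_rpow {a : ℝ} (ha : 0 < a) :
    IntegrableOn (fun t ↦ (∑ k ∈ Finset.Icc 1 ⌊t⌋₊, primeCoeff k) * t ^ (-(a + 1)))
      (Set.Ioi 1) := by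
  refine integrableOn_mul_rpow_of_le measurable_sum_primeCoeff
    (C := 2 / (a / 2) * (1 + 2 / (a / 2))) (r := a / 2) (fun t ht ↦ ?_) (half_lt_self ha)
  rw [abs_of_nonneg (Finset.sum_nonneg fun k _ ↦ primeCoeff_nonneg k)]
  refine (sum_primeCoeff_le (half_pos ha) (Nat.le_floor (by simpa using ht.le))).trans ?_
  gcongr
  exact Nat.floor_le (by linarith)

lemma integrableOn_log_mul_rpow {a : ℝ} (ha : 0 < a) :
    IntegrableOn (fun t ↦ Real.log t * t ^ (-(a + 1))) (Set.Ioi 1) := by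
  refine integrableOn_mul_rpow_of_le Real.measurable_log (C := (a / 2)⁻¹) (r := a / 2)
    (fun t ht ↦ ?_) (half_lt_self ha)
  rw [abs_of_nonneg (Real.log_nonneg ht.le), mul_comm, ← div_eq_mul_inv]
  exact Real.log_le_rpow_div (by linarith) (half_pos ha)

lemma integral_log_mul_cpow {s : ℂ} (hs : 0 < s.re) :
    ∫ t in Set.Ioi (1 : ℝ), (Real.log t : ℂ) * (t : ℂ) ^ (-(s + 1)) = 1 / s ^ 2 := by
  have hs0 : s ≠ 0 := Complex.ne_zero_of_re_pos hs
  have hderiv : ∀ t ∈ Set.Ici (1 : ℝ), HasDerivAt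
      (fun t : ℝ ↦ -((Real.log t : ℂ) * (t : ℂ) ^ (-s) / s) - (t : ℂ) ^ (-s) / s ^ 2)
      ((Real.log t : ℂ) * (t : ℂ) ^ (-(s + 1))) t := fun t ht ↦ by
    have ht0 : 0 < t := lt_of_lt_of_le one_pos ht
    have htc : (t : ℂ) ≠ 0 := by exact_mod_cast ht0.ne'
    have h1 : HasDerivAt (fun t : ℝ ↦ (t : ℂ) ^ (-s)) (-s * (t : ℂ) ^ (-s - 1)) t := by
      have := (hasDerivAt_id (t : ℂ)).cpow_const (c := -s) (Or.inl (by simpa using ht0))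
      simpa using this.comp_ofReal
    have h2 := (Real.hasDerivAt_log ht0.ne').ofReal_comp
    have h3 := ((h2.mul h1).div_const s).neg.sub (h1.div_const (s ^ 2))
    refine h3.congr_deriv ?_
    have h4 : (t : ℂ) ^ (-s) = (t : ℂ) ^ (-s - 1) * t := by
      rw [Complex.cpow_sub _ _ htc, Complex.cpow_one, div_mul_cancel₀ _ htc]
    rw [show -(s + 1) = -s - 1 by ring, h4]
    push_cast
    field_simp
    ring
  have hInt := integrableOn_ofReal_mul_cpow Real.measurable_log
    (integrableOn_log_mul_rpow hs)
  have hlim1 : Tendsto (fun t : ℝ ↦ (t : ℂ) ^ (-s)) atTop (𝓝 0) := by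
    rw [tendsto_zero_iff_norm_tendsto_zero]
    refine (tendsto_rpow_neg_atTop hs).congr' ?_
    filter_upwards [eventually_gt_atTop 0] with t ht
    rw [Complex.norm_cpow_eq_rpow_re_of_pos ht, Complex.neg_re]
  have hlim2 : Tendsto (fun t : ℝ ↦ (Real.log t : ℂ) * (t : ℂ) ^ (-s)) atTop (𝓝 0) := by
    rw [tendsto_zero_iff_norm_tendsto_zero]
    have h := (isLittleO_log_rpow_atTop hs).tendsto_div_nhds_zero.norm
    rw [norm_zero] at h
    refine h.congr' ?_
    filter_upwards [eventually_gt_atTop 0] with t ht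
    rw [norm_div, norm_mul, Complex.norm_cpow_eq_rpow_re_of_pos ht, Complex.neg_re,
      Real.rpow_neg ht.le, Complex.norm_real, Real.norm_of_nonneg (Real.rpow_nonneg ht.le _),
      div_eq_mul_inv]
  have := integral_Ioi_of_hasDerivAt_of_tendsto' hderiv hInt
    ((hlim2.div_const s).neg.sub (hlim1.div_const (s ^ 2)))
  rw [this]
  simp

lemma LSeries_primeCoeff (s : ℂ) :
    LSeries (fun n ↦ (primeCoeff n : ℂ)) s = primeLogSum (1 + s) := by
  have h := tsum_subtype {p : ℕ | p.Prime} fun p : ℕ ↦ (Real.log p : ℂ) * (p : ℂ) ^ (-(1 + s))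
  refine Eq.trans ?_ h.symm
  refine tsum_congr fun n ↦ ?_
  by_cases hn : n.Prime
  · have hn0 : (n : ℂ) ≠ 0 := by exact_mod_cast hn.ne_zero
    rw [LSeries.term_of_ne_zero hn.ne_zero, Set.indicator_of_mem (by exact hn), primeCoeff,
      if_pos hn, neg_add, Complex.cpow_add _ _ hn0, Complex.cpow_neg_one, Complex.cpow_neg]
    push_cast
    ring
  · rw [Set.indicator_of_notMem (by exact hn), LSeries.term, primeCoeff, if_neg hn]
    simp

lemma integrableOn_mertensDelta_mul_rpow {a : ℝ} (ha : 0 < a) :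
    IntegrableOn (fun t ↦ mertensDelta t * t ^ (-(a + 1))) (Set.Ioi 1) := by
  have h3 : IntegrableOn (fun t : ℝ ↦ mertensE * t ^ (-(a + 1))) (Set.Ioi 1) :=
    integrableOn_mul_rpow_of_bounded measurable_const (B := |mertensE|) (fun _ _ ↦ le_rfl) ha
  refine (((integrableOn_sum_primeCoeff_mul_rpow ha).sub (integrableOn_log_mul_rpow ha)).sub
    h3).congr (Eventually.of_forall fun t ↦ ?_)
  simp only [Pi.sub_apply, mertensDelta_eq]
  ring

lemma integral_mertensDelta_mul_cpow {s : ℂ} (hs : 0 < s.re) :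
    s * ∫ t in Set.Ioi (1 : ℝ), (mertensDelta t : ℂ) * (t : ℂ) ^ (-(s + 1)) =
      primeLogSum (1 + s) - 1 / s - mertensE := by
  have hs0 : s ≠ 0 := Complex.ne_zero_of_re_pos hs
  have h1 := integrableOn_ofReal_mul_cpow measurable_sum_primeCoeff
    (integrableOn_sum_primeCoeff_mul_rpow hs)
  have h2 := integrableOn_ofReal_mul_cpow Real.measurable_log (integrableOn_log_mul_rpow hs)
  have h3 := integrableOn_ofReal_mul_cpow (s := s) (measurable_const (a := mertensE))
    (integrableOn_mul_rpow_of_bounded measurable_const (B := |mertensE|) (fun _ _ ↦ le_rfl) hs)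
  have hE : ∫ t in Set.Ioi (1 : ℝ), (mertensE : ℂ) * (t : ℂ) ^ (-(s + 1)) = mertensE / s := by
    rw [integral_const_mul, integral_Ioi_cpow_of_lt (by simpa using hs) one_pos]
    simp [div_eq_mul_inv]
  have hL := LSeries_eq_mul_integral_of_nonneg primeCoeff (half_pos hs).le (half_lt_self hs)
    (Asymptotics.IsBigO.of_bound _ (by
      filter_upwards [eventually_ge_atTop 1] with n hn
      rw [Real.norm_of_nonneg (Finset.sum_nonneg fun k _ ↦ primeCoeff_nonneg k),
        Real.norm_of_nonneg (by positivity)]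
      exact sum_primeCoeff_le (half_pos hs) hn)) primeCoeff_nonneg
  rw [LSeries_primeCoeff] at hL
  have hsplit : ∀ t : ℝ, (mertensDelta t : ℂ) * (t : ℂ) ^ (-(s + 1)) =
      ((∑ k ∈ Finset.Icc 1 ⌊t⌋₊, primeCoeff k : ℝ) : ℂ) * (t : ℂ) ^ (-(s + 1)) -
        (Real.log t : ℂ) * (t : ℂ) ^ (-(s + 1)) - (mertensE : ℂ) * (t : ℂ) ^ (-(s + 1)) :=
    fun t ↦ by rw [mertensDelta_eq]; push_cast; ring
  simp_rw [hsplit]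
  rw [integral_sub (by exact h1.sub h2) h3, integral_sub h1 h2, integral_log_mul_cpow hs, hE, mul_sub,
    mul_sub, hL]
  push_cast
  field_simp

/-- The closed form of `s * ∫ G t * t ^ (-(s + 1)) dt`, where `G` is `ε * mertensDelta` increased
by the constant `C` on `(1, X]`. -/
noncomputable def mertensKernel (ε C X : ℝ) (s : ℂ) : ℂ :=
  C * (1 - (X : ℂ) ^ (-s)) +
    ε * (-mertensE - logDeriv riemannZeta₁ (1 + s) - primeTail 2 (1 + s))

/-- A measure whose exponential moments against `-log` are given by `mertensKernel` on the right
half plane. -/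
structure IsMertensMeasure (ε C X : ℝ) (μ : Measure ℝ) : Prop where
  ne_zero : ε ≠ 0
  pos : 0 < X
  ae_nonpos : ∀ᵐ t ∂μ, -Real.log t ≤ 0
  Ioi_zero_subset : Set.Ioi 0 ⊆ integrableExpSet (fun t ↦ -Real.log t) μ
  mul_complexMGF : ∀ s : ℂ, 0 < s.re →
    s * complexMGF (fun t ↦ -Real.log t) μ s = mertensKernel ε C X s

lemma integral_indicator_mul_cpow {s : ℂ} (hs : s ≠ 0) {C X : ℝ} (hX : 1 < X) :
    s * ∫ t in Set.Ioi (1 : ℝ), (((Set.Iic X).indicator (fun _ ↦ C) t : ℝ) : ℂ) *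
      (t : ℂ) ^ (-(s + 1)) = C * (1 - (X : ℂ) ^ (-s)) := by
  have h : ∀ t : ℝ, (((Set.Iic X).indicator (fun _ ↦ C) t : ℝ) : ℂ) * (t : ℂ) ^ (-(s + 1)) =
      (Set.Iic X).indicator (fun t : ℝ ↦ (C : ℂ) * (t : ℂ) ^ (-(s + 1))) t := fun t ↦ by
    by_cases ht : t ∈ Set.Iic X
    · rw [Set.indicator_of_mem ht, Set.indicator_of_mem ht]
    · rw [Set.indicator_of_notMem ht, Set.indicator_of_notMem ht]
      simp
  simp_rw [h]
  rw [setIntegral_indicator measurableSet_Iic, Set.Ioi_inter_Iic,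
    ← intervalIntegral.integral_of_le hX.le, intervalIntegral.integral_const_mul, integral_cpow]
  · rw [show -(s + 1) + 1 = -s by ring]
    simp only [Complex.ofReal_one, Complex.one_cpow]
    field_simp
    ring
  · right
    refine ⟨fun h ↦ hs ?_, ?_⟩
    · linear_combination -h
    · rw [Set.uIcc_of_le hX.le, Set.mem_Icc]
      intro h
      linarith [h.1]

lemma exists_abs_mertensDelta_le (X : ℝ) : ∃ C, ∀ t, 1 < t → t ≤ X → |mertensDelta t| ≤ C := by
  refine ⟨2 / 1 * (1 + 2 / 1) * X + X + |mertensE|, fun t ht htX ↦ ?_⟩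
  have h1 := sum_primeCoeff_le one_pos (Nat.le_floor (by simpa using ht.le) : 1 ≤ ⌊t⌋₊)
  have h2 : (⌊t⌋₊ : ℝ) ≤ X := (Nat.floor_le (by linarith)).trans htX
  have h3 : Real.log t ≤ X := (Real.log_le_self (by linarith)).trans htX
  have h4 := Real.log_nonneg ht.le
  have h5 : 0 ≤ ∑ k ∈ Finset.Icc 1 ⌊t⌋₊, primeCoeff k :=
    Finset.sum_nonneg fun k _ ↦ primeCoeff_nonneg k
  rw [Real.rpow_one] at h1
  rw [mertensDelta_eq, abs_le]
  have := neg_abs_le mertensE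
  have := le_abs_self mertensE
  constructor <;> nlinarith

lemma exists_isMertensMeasure {ε X : ℝ} (hε : |ε| = 1) (hX : 1 < X)
    (hsign : ∀ t, X < t → 0 ≤ ε * mertensDelta t) :
    ∃ C : ℝ, ∃ μ : Measure ℝ, IsMertensMeasure ε C X μ := by
  obtain ⟨C, hC⟩ := exists_abs_mertensDelta_le X
  have hC0 : 0 ≤ C := (abs_nonneg _).trans (hC X hX le_rfl)
  set G : ℝ → ℝ := fun t ↦ ε * mertensDelta t + (Set.Iic X).indicator (fun _ ↦ C) t with hGdef
  have hm1 : Measurable fun t ↦ ε * mertensDelta t := measurable_mertensDelta.const_mul ε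
  have hm2 : Measurable ((Set.Iic X).indicator fun _ ↦ C) :=
    measurable_const.indicator measurableSet_Iic
  have hG : Measurable G := hm1.add hm2
  have hG0 : ∀ t, 1 < t → 0 ≤ G t := fun t ht ↦ by
    rcases le_or_gt t X with h | h
    · have h1 := hC t ht h
      have h2 : |ε * mertensDelta t| ≤ C := by rwa [abs_mul, hε, one_mul]
      simp only [hGdef, Set.indicator_of_mem (Set.mem_Iic.2 h)]
      linarith [neg_abs_le (ε * mertensDelta t)]
    · simp only [hGdef, Set.indicator_of_notMem (by simpa using h : t ∉ Set.Iic X), add_zero]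
      exact hsign t h
  have hi1 {a : ℝ} (ha : 0 < a) :
      IntegrableOn (fun t ↦ (ε * mertensDelta t) * t ^ (-(a + 1))) (Set.Ioi 1) := by
    simp_rw [mul_assoc]
    exact (integrableOn_mertensDelta_mul_rpow ha).const_mul ε
  have hi2 {a : ℝ} (ha : 0 < a) :
      IntegrableOn (fun t ↦ (Set.Iic X).indicator (fun _ ↦ C) t * t ^ (-(a + 1))) (Set.Ioi 1) := by
    refine integrableOn_mul_rpow_of_bounded hm2 (B := C) (fun t _ ↦ ?_) ha
    rw [abs_of_nonneg (Set.indicator_nonneg (fun _ _ ↦ hC0) t)]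
    exact Set.indicator_le_self' (fun _ _ ↦ hC0) t
  refine ⟨C, mellinMeasure G, by rintro rfl; simp at hε, by linarith, ?_, fun a ha ↦ ?_,
    fun s hs ↦ ?_⟩
  · have h : ∀ᵐ t ∂(volume.restrict (Set.Ioi (1 : ℝ))), -Real.log t ≤ 0 := by
      filter_upwards [ae_restrict_mem measurableSet_Ioi] with t ht
      linarith [Real.log_nonneg (le_of_lt ht)]
    exact (withDensity_absolutelyContinuous _ _).ae_le h
  · rw [mem_integrableExpSet_mellinMeasure hG hG0]
    refine ((hi1 ha).add (hi2 ha)).congr (Eventually.of_forall fun t ↦ ?_)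
    simp only [Pi.add_apply, hGdef]
    ring
  · have hs0 : s ≠ 0 := Complex.ne_zero_of_re_pos hs
    rw [complexMGF_mellinMeasure hG hG0]
    have hsplit : ∀ t : ℝ, (G t : ℂ) * (t : ℂ) ^ (-(s + 1)) =
        ((ε * mertensDelta t : ℝ) : ℂ) * (t : ℂ) ^ (-(s + 1)) +
          (((Set.Iic X).indicator (fun _ ↦ C) t : ℝ) : ℂ) * (t : ℂ) ^ (-(s + 1)) := fun t ↦ by
      simp only [hGdef]
      push_cast
      ring
    simp_rw [hsplit]
    rw [integral_add (integrableOn_ofReal_mul_cpow hm1 (hi1 hs))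
      (integrableOn_ofReal_mul_cpow hm2 (hi2 hs)), mul_add, integral_indicator_mul_cpow hs0 hX]
    simp_rw [Complex.ofReal_mul, mul_assoc]
    have hre : 1 < (1 + s).re := by simpa using hs
    have hV := primeTail_sub_succ (k := 1) (w := 1 + s) (by simpa using hs)
    rw [Nat.cast_one, one_mul] at hV
    rw [integral_const_mul, mul_left_comm, integral_mertensDelta_mul_cpow hs, mertensKernel,
      logDeriv_riemannZeta₁_eq hre, add_sub_cancel_left, ← hV, add_comm]
    congr 2
    ring

lemma mertensKernel_zero {ε C X : ℝ} : mertensKernel ε C X 0 = 0 := by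
  simp [mertensKernel, mertensE_eq]

namespace IsMertensMeasure

variable {ε C X : ℝ} {μ : Measure ℝ}

lemma mem_of_le (h : IsMertensMeasure ε C X μ) {a b : ℝ} (hab : a ≤ b)
    (ha : a ∈ integrableExpSet (fun t ↦ -Real.log t) μ) :
    b ∈ integrableExpSet (fun t ↦ -Real.log t) μ := by
  refine Integrable.mono' (show Integrable _ μ from ha) (by fun_prop) ?_
  filter_upwards [h.ae_nonpos] with t ht
  rw [Real.norm_of_nonneg (Real.exp_pos _).le, Real.exp_le_exp]
  exact mul_le_mul_of_nonpos_right hab ht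

/-- The functional equation satisfied by the transform, cleared of denominators. -/
lemma zeta_mul_eq (h : IsMertensMeasure ε C X μ) {b : ℝ} (hb : -1 / 2 ≤ b) (hb0 : b ≤ 0)
    (hsub : Set.Ioi b ⊆ integrableExpSet (fun t ↦ -Real.log t) μ) {s : ℂ} (hs : b < s.re) :
    riemannZeta₁ (1 + s) * (s * complexMGF (fun t ↦ -Real.log t) μ s - C * (1 - (X : ℂ) ^ (-s)) +
      ε * mertensE + ε * primeTail 2 (1 + s)) = -ε * deriv riemannZeta₁ (1 + s) := by
  have hXc : (X : ℂ) ≠ 0 := by exact_mod_cast h.pos.ne'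
  set U : Set ℂ := {s | b < s.re} with hU
  have hUo : IsOpen U := isOpen_lt continuous_const Complex.continuous_re
  have hz (z : ℂ) : AnalyticAt ℂ riemannZeta₁ z :=
    differentiable_riemannZeta₁.analyticAt z
  have hl (z : ℂ) : AnalyticAt ℂ (fun s : ℂ ↦ 1 + s) z := by fun_prop
  have hL : AnalyticOnNhd ℂ (fun s ↦ riemannZeta₁ (1 + s) *
      (s * complexMGF (fun t ↦ -Real.log t) μ s - C * (1 - (X : ℂ) ^ (-s)) +
      ε * mertensE + ε * primeTail 2 (1 + s))) U := fun z hz' ↦ by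
    have hzb : b < z.re := hz'
    have h1 : AnalyticAt ℂ (complexMGF (fun t ↦ -Real.log t) μ) z :=
      analyticAt_complexMGF (interior_mono hsub (by rwa [interior_Ioi]))
    have h2 : AnalyticAt ℂ (fun s ↦ primeTail 2 (1 + s)) z :=
      (analyticAt_primeTail (by simp; linarith)).comp (hl z)
    have h3 : AnalyticAt ℂ (fun s : ℂ ↦ (X : ℂ) ^ (-s)) z := by
      simp_rw [Complex.cpow_def_of_ne_zero hXc]
      fun_prop
    have h4 : AnalyticAt ℂ (fun s ↦ riemannZeta₁ (1 + s)) z := (hz _).comp (hl z)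
    fun_prop
  have hR : AnalyticOnNhd ℂ (fun s ↦ -ε * deriv riemannZeta₁ (1 + s)) U := fun z _ ↦
    analyticAt_const.mul ((hz _).deriv.comp (hl z))
  refine hL.eqOn_of_preconnected_of_eventuallyEq hR
    ((convex_halfSpace_re_gt b).isPreconnected) (z₀ := 1)
    (show b < (1 : ℂ).re by simp; linarith) ?_ hs
  filter_upwards [(isOpen_lt continuous_const Complex.continuous_re).mem_nhds
    (show (0 : ℝ) < (1 : ℂ).re by simp)] with w hw
  have hw0 : 0 < w.re := hw
  have hne : riemannZeta₁ (1 + w) ≠ 0 := riemannZeta₁_ne_zero_of_one_le_re (by simp; linarith)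
  rw [h.mul_complexMGF w hw0, mertensKernel, logDeriv_apply]
  field_simp
  ring

lemma mul_complexMGF_of_ne_zero (h : IsMertensMeasure ε C X μ) {b : ℝ} (hb : -1 / 2 ≤ b)
    (hb0 : b ≤ 0) (hsub : Set.Ioi b ⊆ integrableExpSet (fun t ↦ -Real.log t) μ) {s : ℂ}
    (hs : b < s.re) (hne : riemannZeta₁ (1 + s) ≠ 0) :
    s * complexMGF (fun t ↦ -Real.log t) μ s = mertensKernel ε C X s := by
  have := h.zeta_mul_eq hb hb0 hsub hs
  rw [mertensKernel, logDeriv_apply]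
  field_simp
  linear_combination this

lemma Ioi_neg_half_subset (h : IsMertensMeasure ε C X μ) :
    Set.Ioi (-1 / 2) ⊆ integrableExpSet (fun t ↦ -Real.log t) μ := by
  by_contra hcon
  obtain ⟨a, ha, haA⟩ := Set.not_subset.1 hcon
  have hXc : (X : ℂ) ≠ 0 := by exact_mod_cast h.pos.ne'
  set B := (integrableExpSet (fun t ↦ -Real.log t) μ)ᶜ with hB
  have hBle : ∀ x ∈ B, x ≤ 0 := fun x hx ↦ by
    by_contra! hx0
    exact hx (h.Ioi_zero_subset hx0)
  have hbdd : BddAbove B := ⟨0, hBle⟩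
  set b := sSup B with hbdef
  have hab : a ≤ b := le_csSup hbdd haA
  have hb0 : b ≤ 0 := csSup_le ⟨a, haA⟩ hBle
  have hb : -1 / 2 < b := lt_of_lt_of_le ha hab
  have hsub : Set.Ioi b ⊆ integrableExpSet (fun t ↦ -Real.log t) μ := fun x hx ↦ by
    by_contra hxA
    exact absurd (le_csSup hbdd hxA) (not_le.2 hx)
  have hcont : Continuous fun s : ℂ ↦ riemannZeta₁ (1 + s) :=
    differentiable_riemannZeta₁.continuous.comp (by fun_prop)
  set U : Set ℂ := {s | -1 / 2 < s.re} ∩ {s | riemannZeta₁ (1 + s) ≠ 0} with hU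
  have hUo : IsOpen U := (isOpen_lt continuous_const Complex.continuous_re).inter
    (isOpen_ne_fun hcont continuous_const)
  have h0U : (0 : ℂ) ∈ U := ⟨by norm_num, by simp⟩
  have hbU : (b : ℂ) ∈ U := ⟨by simpa using hb, by
    have := riemannZeta₁_ofReal_ne_zero (σ := 1 + b) (by linarith) (by linarith)
    simpa using this⟩
  have hKd : DifferentiableOn ℂ (mertensKernel ε C X) U := fun z hz ↦ by
    have hz1 : -1 / 2 < z.re := hz.1
    have hz2 : riemannZeta₁ (1 + z) ≠ 0 := hz.2
    have hl : AnalyticAt ℂ (fun s : ℂ ↦ 1 + s) z := by fun_prop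
    have h2 : AnalyticAt ℂ (fun s ↦ primeTail 2 (1 + s)) z :=
      (analyticAt_primeTail (by simp; linarith)).comp hl
    have h3 : AnalyticAt ℂ (fun s : ℂ ↦ (X : ℂ) ^ (-s)) z := by
      simp_rw [Complex.cpow_def_of_ne_zero hXc]
      fun_prop
    have h4 : AnalyticAt ℂ (fun s ↦ logDeriv riemannZeta₁ (1 + s)) z := by
      have hz' := differentiable_riemannZeta₁.analyticAt (1 + z)
      exact (hz'.deriv.div hz' hz2).comp hl
    have : AnalyticAt ℂ (mertensKernel ε C X) z := by
      unfold mertensKernel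
      fun_prop
    exact this.differentiableAt.differentiableWithinAt
  have hg : AnalyticAt ℂ (dslope (mertensKernel ε C X) 0) b :=
    ((Complex.differentiableOn_dslope (hUo.mem_nhds h0U)).2 hKd).analyticAt (hUo.mem_nhds hbU)
  have hne0 : ∀ᶠ s in 𝓝 (b : ℂ), b < s.re → s ≠ 0 := by
    rcases hb0.lt_or_eq with hlt | heq
    · filter_upwards [isOpen_ne.mem_nhds (show (b : ℂ) ≠ 0 by exact_mod_cast hlt.ne)] with s hs _
      exact hs
    · refine Eventually.of_forall fun s hs hs0 ↦ ?_
      rw [hs0, heq] at hs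
      simp at hs
  obtain ⟨δ, hδ, hmem⟩ := exists_sub_mem_integrableExpSet (by fun_prop) h.ae_nonpos hsub hg (by
    filter_upwards [hne0, hUo.mem_nhds hbU] with s h1 h2 h3
    have hs0 := h1 h3
    have := h.mul_complexMGF_of_ne_zero hb.le hb0 hsub h3 h2.2
    rw [dslope_of_ne _ hs0, slope_def_field, mertensKernel_zero, sub_zero, sub_zero, ← this,
      mul_div_cancel_left₀ _ hs0])
  have : b ≤ b - δ := csSup_le ⟨a, haA⟩ fun x hx ↦ by
    by_contra! hlt
    exact hx (h.mem_of_le hlt.le hmem)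
  linarith

/-- A one-signed error term forces the Riemann hypothesis. -/
lemma riemannZeta₁_ne_zero (h : IsMertensMeasure ε C X μ) (s : ℂ) (hs : 1 / 2 < s.re) :
    riemannZeta₁ s ≠ 0 := by
  intro hzero
  have hsub := h.Ioi_neg_half_subset
  have hXc : (X : ℂ) ≠ 0 := by exact_mod_cast h.pos.ne'
  have hεc : (ε : ℂ) ≠ 0 := by exact_mod_cast h.ne_zero
  set k : ℂ → ℂ := fun z ↦ ((z - 1) * complexMGF (fun t ↦ -Real.log t) μ (z - 1) -
    C * (1 - (X : ℂ) ^ (-(z - 1))) + ε * mertensE + ε * primeTail 2 z) / (-ε) with hk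
  have hkc : ContinuousAt k s := by
    have hl : ContinuousAt (fun z : ℂ ↦ z - 1) s := by fun_prop
    have h1 : ContinuousAt (fun z ↦ complexMGF (fun t ↦ -Real.log t) μ (z - 1)) s :=
      ContinuousAt.comp (g := complexMGF (fun t ↦ -Real.log t) μ) (analyticAt_complexMGF
        (interior_mono hsub (by
          rw [interior_Ioi, Complex.sub_re, Complex.one_re]
          exact Set.mem_Ioi.2 (by linarith)))).continuousAt hl
    have h2 : ContinuousAt (primeTail 2) s := (analyticAt_primeTail (by
      push_cast
      linarith)).continuousAt
    have h3 : ContinuousAt (fun z : ℂ ↦ (X : ℂ) ^ (-(z - 1))) s := by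
      simp_rw [Complex.cpow_def_of_ne_zero hXc]
      fun_prop
    fun_prop
  have hbound : ∀ᶠ z in 𝓝[≠] s, ‖(z - s) * logDeriv riemannZeta₁ z‖ ≤ ‖(z - s) * k z‖ := by
    filter_upwards [mem_nhdsWithin_of_mem_nhds
      ((isOpen_lt continuous_const Complex.continuous_re).mem_nhds hs)] with z hz
    have hz' : 1 / 2 < z.re := hz
    rw [norm_mul, norm_mul]
    gcongr
    by_cases hz0 : riemannZeta₁ z = 0
    · rw [logDeriv_apply, hz0, div_zero, norm_zero]
      exact norm_nonneg _
    · have := h.zeta_mul_eq (s := z - 1) le_rfl (by norm_num) hsub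
        (by rw [Complex.sub_re, Complex.one_re]; linarith)
      rw [add_sub_cancel] at this
      refine le_of_eq (congrArg norm ?_)
      rw [logDeriv_apply, hk]
      field_simp
      linear_combination this
  have hlim : Tendsto (fun z ↦ (z - s) * k z) (𝓝[≠] s) (𝓝 0) := by
    have : ContinuousAt (fun z ↦ (z - s) * k z) s := by fun_prop
    have := this.tendsto.mono_left (nhdsWithin_le_nhds (s := {s}ᶜ))
    simpa using this
  have h1 := tendsto_sub_mul_logDeriv differentiable_riemannZeta₁
    (analyticOrderAt_riemannZeta₁_ne_top s)
  have h2 : Tendsto (fun z ↦ (z - s) * logDeriv riemannZeta₁ z) (𝓝[≠] s) (𝓝 0) :=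
    squeeze_zero_norm' hbound (by simpa using hlim.norm)
  have h3 := tendsto_nhds_unique h1 h2
  have h4 := one_le_analyticOrderNatAt_of_zero hzero
  rw [Nat.cast_eq_zero] at h3
  omega

lemma mul_complexMGF_eq (h : IsMertensMeasure ε C X μ) {s : ℂ} (hs : -1 / 2 < s.re) :
    s * complexMGF (fun t ↦ -Real.log t) μ s = mertensKernel ε C X s :=
  h.mul_complexMGF_of_ne_zero le_rfl (by norm_num) h.Ioi_neg_half_subset hs
    (h.riemannZeta₁_ne_zero _ (by simp; linarith))

end IsMertensMeasure

lemma tendsto_ofReal_nhdsGT_zero : Tendsto (fun δ : ℝ ↦ (δ : ℂ)) (𝓝[>] 0) (𝓝 0) := by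
  have : Tendsto (fun δ : ℝ ↦ (δ : ℂ)) (𝓝 0) (𝓝 ((0 : ℝ) : ℂ)) :=
    Complex.continuous_ofReal.tendsto 0
  rw [Complex.ofReal_zero] at this
  exact this.mono_left nhdsWithin_le_nhds

lemma tendsto_mul_of_continuousAt {f : ℂ → ℂ} {c k : ℂ} (hf : ContinuousAt f c) :
    Tendsto (fun δ : ℝ ↦ (δ : ℂ) * f (c + k * δ)) (𝓝[>] 0) (𝓝 0) := by
  have h1 : Tendsto (fun δ : ℝ ↦ c + k * δ) (𝓝[>] 0) (𝓝 c) := by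
    simpa using (tendsto_ofReal_nhdsGT_zero.const_mul k).const_add c
  simpa using tendsto_ofReal_nhdsGT_zero.mul (hf.tendsto.comp h1)

lemma tendsto_mul_logDeriv_riemannZeta₁ (ρ : ℂ) :
    Tendsto (fun δ : ℝ ↦ (δ : ℂ) * logDeriv riemannZeta₁ (ρ + δ)) (𝓝[>] 0)
      (𝓝 (analyticOrderNatAt riemannZeta₁ ρ)) := by
  have h := tendsto_sub_mul_logDeriv differentiable_riemannZeta₁
    (analyticOrderAt_riemannZeta₁_ne_top ρ)
  have h1 : Tendsto (fun δ : ℝ ↦ ρ + δ) (𝓝[>] 0) (𝓝[≠] ρ) := by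
    refine tendsto_nhdsWithin_iff.2 ⟨?_, ?_⟩
    · simpa using tendsto_ofReal_nhdsGT_zero.const_add ρ
    · filter_upwards [self_mem_nhdsWithin] with δ hδ
      have : (δ : ℂ) ≠ 0 := by exact_mod_cast (ne_of_gt hδ)
      simpa using this
  refine (h.comp h1).congr fun δ ↦ ?_
  simp

lemma tendsto_mul_primeTail_two (l : ℝ) :
    Tendsto (fun δ : ℝ ↦ (δ : ℂ) * primeTail 2 (1 / 2 + l * Complex.I + δ)) (𝓝[>] 0)
      (𝓝 (if l = 0 then 1 / 2 else 0)) := by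
  have hpole : Tendsto (fun δ : ℝ ↦ (δ : ℂ) * (1 / (2 * δ + 2 * l * Complex.I))) (𝓝[>] 0)
      (𝓝 (if l = 0 then 1 / 2 else 0)) := by
    split_ifs with hl
    · refine tendsto_const_nhds.congr' ?_
      filter_upwards [self_mem_nhdsWithin] with δ hδ
      have : (δ : ℂ) ≠ 0 := by exact_mod_cast (ne_of_gt hδ)
      rw [hl]
      simp only [Complex.ofReal_zero, mul_zero, zero_mul, add_zero]
      field_simp
    · have hc : ContinuousAt (fun z : ℂ ↦ 1 / z) (2 * l * Complex.I) :=
        continuousAt_const.div continuousAt_id (by simp [hl])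
      refine (tendsto_mul_of_continuousAt (k := 2) hc).congr fun δ ↦ ?_
      rw [add_comm]
  have hre : ((1 : ℂ) + 2 * l * Complex.I).re = 1 := by simp
  have hlog : ContinuousAt (logDeriv riemannZeta₁) (1 + 2 * l * Complex.I) := by
    have hz := differentiable_riemannZeta₁.analyticAt (1 + 2 * l * Complex.I)
    exact (hz.deriv.div hz (riemannZeta₁_ne_zero_of_one_le_re hre.ge)).continuousAt
  have h2 : ContinuousAt (primeTail 2) (1 + 2 * l * Complex.I) :=
    (analyticAt_primeTail (by rw [hre]; norm_num)).continuousAt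
  have h3 : ContinuousAt (primeTail 3) (1 / 2 + l * Complex.I) :=
    (analyticAt_primeTail (by simp; norm_num)).continuousAt
  have h := ((hpole.sub (tendsto_mul_of_continuousAt (k := 2) hlog)).sub
    (tendsto_mul_of_continuousAt (k := 2) h2)).add (tendsto_mul_of_continuousAt (k := 1) h3)
  simp only [sub_zero, add_zero] at h
  refine h.congr' ?_
  filter_upwards [self_mem_nhdsWithin] with δ hδ
  have hδ0 : 0 < δ := hδ
  have hw : 1 < (1 + 2 * l * Complex.I + 2 * δ : ℂ).re := by simp [hδ0]
  have e1 := primeTail_sub_succ (k := 2) (w := 1 / 2 + l * Complex.I + δ) (by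
    simp
    linarith)
  have e2 := primeTail_sub_succ (k := 1) (w := 1 + 2 * l * Complex.I + 2 * δ) (by
    rw [Nat.cast_one, one_mul]
    exact hw)
  have e3 := logDeriv_riemannZeta₁_eq hw
  rw [show ((2 : ℕ) : ℂ) * (1 / 2 + l * Complex.I + δ) = 1 + 2 * l * Complex.I + 2 * δ by
    push_cast; ring] at e1
  rw [Nat.cast_one, one_mul] at e2
  rw [show (1 + 2 * l * Complex.I + 2 * δ - 1 : ℂ) = 2 * δ + 2 * l * Complex.I by ring] at e3
  simp only [one_mul]
  linear_combination (-(δ : ℂ)) * e1 + (δ : ℂ) * e2 - (δ : ℂ) * e3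

/-- The residue-type limit of the transform at the point `-1 / 2 + l * I`. -/
noncomputable def mertensResidue (ε l : ℝ) : ℂ :=
  ε * (analyticOrderNatAt riemannZeta₁ (1 / 2 + l * Complex.I) + if l = 0 then 1 / 2 else 0) /
    (1 / 2 - l * Complex.I)

lemma half_sub_mul_I_ne_zero (l : ℝ) : (1 / 2 - l * Complex.I : ℂ) ≠ 0 := fun h ↦ by
  simpa using congrArg Complex.re h

lemma IsMertensMeasure.tendsto_mul_complexMGF {ε C X : ℝ} {μ : Measure ℝ}
    (h : IsMertensMeasure ε C X μ) (l : ℝ) :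
    Tendsto (fun δ : ℝ ↦ (δ : ℂ) * complexMGF (fun t ↦ -Real.log t) μ
      ((-1 / 2 + δ : ℝ) + l * Complex.I)) (𝓝[>] 0) (𝓝 (mertensResidue ε l)) := by
  have hXc : (X : ℂ) ≠ 0 := by exact_mod_cast h.pos.ne'
  have h1 : Tendsto (fun δ : ℝ ↦ (δ : ℂ) *
      (C * (1 - (X : ℂ) ^ (-(-1 / 2 + l * Complex.I + 1 * δ))) - ε * mertensE)) (𝓝[>] 0) (𝓝 0) := by
    refine tendsto_mul_of_continuousAt
      (f := fun s : ℂ ↦ C * (1 - (X : ℂ) ^ (-s)) - ε * mertensE) ?_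
    simp_rw [Complex.cpow_def_of_ne_zero hXc]
    fun_prop
  have h2 := (h1.sub ((tendsto_mul_logDeriv_riemannZeta₁ (1 / 2 + l * Complex.I)).const_mul
    (ε : ℂ))).sub ((tendsto_mul_primeTail_two l).const_mul (ε : ℂ))
  have h3 : Tendsto (fun δ : ℝ ↦ -1 / 2 + l * Complex.I + δ) (𝓝[>] 0)
      (𝓝 (-1 / 2 + l * Complex.I)) := by
    simpa using tendsto_ofReal_nhdsGT_zero.const_add (-1 / 2 + l * Complex.I)
  have hne : (-1 / 2 + l * Complex.I : ℂ) ≠ 0 := fun h ↦ half_sub_mul_I_ne_zero l (by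
    linear_combination -h)
  have h4 := h2.div h3 hne
  have hlim : mertensResidue ε l = (0 - ε * (analyticOrderNatAt riemannZeta₁
      (1 / 2 + l * Complex.I) : ℂ) - ε * (if l = 0 then 1 / 2 else 0)) /
        (-1 / 2 + l * Complex.I) := by
    rw [mertensResidue, div_eq_div_iff (half_sub_mul_I_ne_zero l) hne]
    ring
  rw [hlim]
  have hne' : ∀ᶠ δ : ℝ in 𝓝[>] 0, (-1 / 2 + l * Complex.I + δ : ℂ) ≠ 0 :=
    h3.eventually_ne hne
  refine h4.congr' ?_
  filter_upwards [self_mem_nhdsWithin, hne'] with δ hδ hne'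
  have hδ0 : 0 < δ := hδ
  have hs : ((-1 / 2 + δ : ℝ) + l * Complex.I : ℂ) = -1 / 2 + l * Complex.I + δ := by
    push_cast
    ring
  have hK := h.mul_complexMGF_eq (s := (-1 / 2 + δ : ℝ) + l * Complex.I) (by simpa using hδ0)
  rw [hs] at hK ⊢
  rw [Pi.div_apply, div_eq_iff hne']
  rw [mertensKernel, show (1 + (-1 / 2 + l * Complex.I + δ) : ℂ) = 1 / 2 + l * Complex.I + δ by
    ring] at hK
  rw [one_mul]
  linear_combination -(δ : ℂ) * hK

/-- The error term is not eventually nonpositive. -/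
lemma not_isMertensMeasure_neg_one {C X : ℝ} {μ : Measure ℝ} :
    ¬ IsMertensMeasure (-1) C X μ := fun h ↦ by
  have h1 := (Complex.continuous_re.tendsto _).comp (h.tendsto_mul_complexMGF 0)
  have h2 : 0 ≤ (mertensResidue (-1) 0).re := by
    refine ge_of_tendsto h1 ?_
    filter_upwards [self_mem_nhdsWithin] with δ hδ
    rw [Function.comp_apply, Complex.ofReal_zero, zero_mul, add_zero, complexMGF_ofReal,
      ← Complex.ofReal_mul, Complex.ofReal_re]
    exact mul_nonneg (le_of_lt hδ) mgf_nonneg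
  have h3 : mertensResidue (-1) 0 =
      ((-(2 * analyticOrderNatAt riemannZeta₁ (1 / 2 + (0 : ℝ) * Complex.I) + 1) : ℝ) : ℂ) := by
    rw [mertensResidue]
    push_cast
    simp only [if_true, zero_mul]
    ring
  rw [h3, Complex.ofReal_re] at h2
  have : (0 : ℝ) ≤ analyticOrderNatAt riemannZeta₁ (1 / 2 + (0 : ℝ) * Complex.I) := by positivity
  linarith

/-- Complex moment generating functions are of positive type along vertical lines. -/
lemma sum_complexMGF_re_nonneg {Ω : Type*} {mΩ : MeasurableSpace Ω} {μ : Measure Ω} {Y : Ω → ℝ}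
    (hY : Measurable Y) {σ : ℝ} (hσ : σ ∈ integrableExpSet Y μ) (F : Finset ℝ) (u : ℝ) :
    0 ≤ (∑ a ∈ F, ∑ b ∈ F, complexMGF Y μ (σ + ((a - b : ℝ) : ℂ) * Complex.I) *
      Complex.exp ((a - b : ℝ) * u * Complex.I)).re := by
  have hInt (l : ℝ) : Integrable (fun ω ↦ Complex.exp ((σ + (l : ℂ) * Complex.I) * Y ω) *
      Complex.exp (l * u * Complex.I)) μ := by
    refine Integrable.mul_const ?_ _
    refine Integrable.mono (show Integrable _ μ from hσ) (by fun_prop)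
      (Eventually.of_forall fun ω ↦ ?_)
    rw [Complex.norm_exp, Real.norm_of_nonneg (Real.exp_pos _).le]
    simp
  have h : ∑ a ∈ F, ∑ b ∈ F, complexMGF Y μ (σ + ((a - b : ℝ) : ℂ) * Complex.I) *
      Complex.exp ((a - b : ℝ) * u * Complex.I) =
      ∫ ω, ((Real.exp (σ * Y ω) *
        Complex.normSq (∑ a ∈ F, Complex.exp (a * (Y ω + u) * Complex.I)) : ℝ) : ℂ) ∂μ := by
    simp only [complexMGF, ← integral_mul_const]
    simp_rw [← integral_finsetSum F fun b _ ↦ hInt _]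
    rw [← integral_finsetSum F fun a _ ↦ integrable_finsetSum F fun b _ ↦ hInt _]
    congr 1 with ω
    push_cast
    rw [Complex.normSq_eq_conj_mul_self, map_sum, mul_comm (∑ a ∈ F, _), Finset.sum_mul_sum,
      Finset.mul_sum]
    refine Finset.sum_congr rfl fun a _ ↦ ?_
    rw [Finset.mul_sum]
    refine Finset.sum_congr rfl fun b _ ↦ ?_
    rw [← Complex.exp_conj, ← Complex.exp_add, ← Complex.exp_add, ← Complex.exp_add]
    congr 1
    simp only [map_mul, map_add, Complex.conj_ofReal, Complex.conj_I]
    ring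
  rw [h, integral_complex_ofReal, Complex.ofReal_re]
  exact integral_nonneg fun ω ↦ mul_nonneg (Real.exp_pos _).le (Complex.normSq_nonneg _)

namespace IsMertensMeasure

variable {ε C X : ℝ} {μ : Measure ℝ}

lemma sum_mertensResidue_mul_exp_re_nonneg (h : IsMertensMeasure ε C X μ) (F : Finset ℝ) (u : ℝ) :
    0 ≤ (∑ a ∈ F, ∑ b ∈ F, mertensResidue ε (a - b) *
      Complex.exp ((a - b : ℝ) * u * Complex.I)).re := by
  have hlim := tendsto_finsetSum F fun a _ ↦ tendsto_finsetSum F fun b _ ↦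
    (h.tendsto_mul_complexMGF (a - b)).mul_const (Complex.exp ((a - b : ℝ) * u * Complex.I))
  refine ge_of_tendsto ((Complex.continuous_re.tendsto _).comp hlim) ?_
  filter_upwards [self_mem_nhdsWithin] with δ hδ
  have hδ0 : 0 < δ := hδ
  simp only [Function.comp_apply, mul_assoc (δ : ℂ), ← Finset.mul_sum, Complex.re_ofReal_mul]
  refine mul_nonneg hδ0.le (sum_complexMGF_re_nonneg (by fun_prop)
    (h.Ioi_neg_half_subset ?_) F u)
  exact Set.mem_Ioi.2 (by linarith)

lemma sum_mertensResidue_div_re_nonneg (h : IsMertensMeasure ε C X μ) {x : ℝ} (hx : 0 < x)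
    (F : Finset ℝ) :
    0 ≤ ∑ a ∈ F, ∑ b ∈ F,
      (mertensResidue ε (a - b) / (x - ((a - b : ℝ) : ℂ) * Complex.I)).re := by
  have hre (l : ℝ) : (-(x - (l : ℂ) * Complex.I)).re < 0 := by simpa using hx
  have hInt (l : ℝ) : IntegrableOn (fun u : ℝ ↦ mertensResidue ε l *
      Complex.exp (-(x - (l : ℂ) * Complex.I) * u)) (Set.Ioi 0) :=
    (integrableOn_exp_mul_complex_Ioi (hre l) 0).const_mul _
  have heq : ∑ a ∈ F, ∑ b ∈ F, mertensResidue ε (a - b) / (x - ((a - b : ℝ) : ℂ) * Complex.I) =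
      ∫ u in Set.Ioi (0 : ℝ), ∑ a ∈ F, ∑ b ∈ F, mertensResidue ε (a - b) *
        Complex.exp (-(x - ((a - b : ℝ) : ℂ) * Complex.I) * u) := by
    rw [integral_finsetSum F fun a _ ↦ integrable_finsetSum F fun b _ ↦ hInt _]
    refine Finset.sum_congr rfl fun a _ ↦ ?_
    rw [integral_finsetSum F fun b _ ↦ hInt _]
    refine Finset.sum_congr rfl fun b _ ↦ ?_
    rw [integral_const_mul, integral_exp_mul_complex_Ioi (hre _)]
    simp only [Complex.ofReal_zero, mul_zero, Complex.exp_zero, neg_div_neg_eq]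
    rw [mul_one_div]
  simp only [← Complex.re_sum]
  rw [heq]
  have hi : IntegrableOn (fun u : ℝ ↦ ∑ a ∈ F, ∑ b ∈ F, mertensResidue ε (a - b) *
        Complex.exp (-(x - ((a - b : ℝ) : ℂ) * Complex.I) * u)) (Set.Ioi 0) :=
    integrable_finsetSum F fun a _ ↦ integrable_finsetSum F fun b _ ↦ hInt _
  rw [← Complex.reCLM_apply, ← ContinuousLinearMap.integral_comp_comm _ hi]
  refine integral_nonneg fun u ↦ ?_
  have hpt : ∑ a ∈ F, ∑ b ∈ F, mertensResidue ε (a - b) *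
        Complex.exp (-(x - ((a - b : ℝ) : ℂ) * Complex.I) * u) =
      (Real.exp (-(x * u)) : ℂ) * ∑ a ∈ F, ∑ b ∈ F, mertensResidue ε (a - b) *
        Complex.exp ((a - b : ℝ) * u * Complex.I) := by
    simp only [Finset.mul_sum]
    refine Finset.sum_congr rfl fun a _ ↦ Finset.sum_congr rfl fun b _ ↦ ?_
    rw [Complex.ofReal_exp, mul_left_comm, ← Complex.exp_add]
    congr 2
    push_cast
    ring
  simp only [Pi.zero_apply, Complex.reCLM_apply]
  rw [hpt, Complex.re_ofReal_mul]
  exact mul_nonneg (Real.exp_pos _).le (h.sum_mertensResidue_mul_exp_re_nonneg F u)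

end IsMertensMeasure

/-- Finitely generated abelian groups have polynomial growth, hence Følner sets. -/
lemma exists_folner {G : Type*} [AddCommGroup G] [DecidableEq G] (S : Finset G) {κ : ℝ}
    (hκ : 0 < κ) : ∃ F : Finset G, F.Nonempty ∧
      ((F.filter fun b ↦ ¬ ∀ l ∈ S, b + l ∈ F).card : ℝ) ≤ κ * F.card := by
  set B : ℕ → Finset G := fun n ↦ (Fintype.piFinset fun _ : S ↦ Finset.range (n + 1)).image
    fun c ↦ ∑ l : S, c l • (l : G) with hB
  have hmem {n : ℕ} {b : G} :
      b ∈ B n ↔ ∃ c : S → ℕ, (∀ l, c l < n + 1) ∧ ∑ l : S, c l • (l : G) = b := by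
    simp [hB]
  have hne (n : ℕ) : 0 ∈ B n := hmem.2 ⟨0, fun _ ↦ Nat.succ_pos n, by simp⟩
  have hmono (n : ℕ) : B n ⊆ B (n + 1) := fun b hb ↦ by
    obtain ⟨c, hc, rfl⟩ := hmem.1 hb
    exact hmem.2 ⟨c, fun l ↦ (hc l).trans (Nat.lt_succ_self _), rfl⟩
  have hadd (n : ℕ) {b l : G} (hb : b ∈ B n) (hl : l ∈ S) : b + l ∈ B (n + 1) := by
    obtain ⟨c, hc, rfl⟩ := hmem.1 hb
    refine hmem.2 ⟨c + Pi.single ⟨l, hl⟩ 1, fun i ↦ ?_, ?_⟩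
    · have := hc i
      by_cases hi : i = ⟨l, hl⟩
      · subst hi
        simpa using this
      · simpa [Pi.single_eq_of_ne hi] using this.trans (Nat.lt_succ_self _)
    · simp only [Pi.add_apply, add_smul, Finset.sum_add_distrib]
      congr 1
      rw [Finset.sum_eq_single ⟨l, hl⟩]
      · simp
      · intro i _ hi
        simp [Pi.single_eq_of_ne hi]
      · simp
  have hcard (n : ℕ) : ((B n).card : ℝ) ≤ ((n : ℝ) + 1) ^ S.card := by
    have := Finset.card_image_le (s := Fintype.piFinset fun _ : S ↦ Finset.range (n + 1))
      (f := fun c ↦ ∑ l : S, c l • (l : G))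
    rw [Fintype.card_piFinset, Finset.prod_const, Finset.card_range, Finset.card_univ,
      Fintype.card_coe] at this
    exact_mod_cast this
  suffices ∃ n : ℕ, ((B (n + 1)).card : ℝ) - (B n).card ≤ κ * (B (n + 1)).card by
    obtain ⟨n, hn⟩ := this
    refine ⟨B (n + 1), ⟨0, hne _⟩, le_trans ?_ hn⟩
    have hsub : (B (n + 1)).filter (fun b ↦ ¬ ∀ l ∈ S, b + l ∈ B (n + 1)) ⊆
        B (n + 1) \ B n := fun b hb ↦ by
      rw [Finset.mem_filter] at hb
      exact Finset.mem_sdiff.2 ⟨hb.1, fun hbn ↦ hb.2 fun l hl ↦ hadd n hbn hl⟩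
    have h1 := Finset.card_le_card hsub
    rw [Finset.card_sdiff_of_subset (hmono n)] at h1
    have h2 : (((B (n + 1)).card - (B n).card : ℕ) : ℝ) =
        ((B (n + 1)).card : ℝ) - (B n).card :=
      Nat.cast_sub (Finset.card_le_card (hmono n))
    rw [← h2]
    exact_mod_cast h1
  by_contra! hcon
  have hstep (n : ℕ) : (1 + κ) * ((B n).card : ℝ) ≤ (B (n + 1)).card := by
    have h1 := hcon n
    have h2 : ((B n).card : ℝ) ≤ (B (n + 1)).card := by
      exact_mod_cast Finset.card_le_card (hmono n)
    nlinarith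
  have hgrow (n : ℕ) : (1 + κ) ^ n ≤ ((B n).card : ℝ) := by
    induction n with
    | zero =>
      have : 0 < (B 0).card := Finset.card_pos.2 ⟨0, hne 0⟩
      rw [pow_zero]
      exact_mod_cast this
    | succ n ih =>
      rw [pow_succ']
      exact (mul_le_mul_of_nonneg_left ih (by linarith)).trans (hstep n)
  have hlim := (tendsto_pow_const_div_const_pow_of_one_lt S.card
    (show (1 : ℝ) < 1 + κ by linarith)).comp (tendsto_add_atTop_nat 1)
  obtain ⟨n, hn⟩ := (hlim.eventually_lt_const (show (0 : ℝ) < (1 + κ)⁻¹ by positivity)).exists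
  have h1 := (hgrow n).trans (hcard n)
  rw [Function.comp_apply, div_lt_iff₀ (by positivity), pow_succ', ← mul_assoc,
    inv_mul_cancel₀ (by linarith), one_mul] at hn
  push_cast at hn
  linarith

/-- A summable function of positive type on a discrete abelian group has nonnegative sum. -/
lemma tsum_nonneg_of_positive_type {G : Type*} [AddCommGroup G] {q : G → ℝ} (hq : Summable q)
    (hpos : ∀ F : Finset G, 0 ≤ ∑ a ∈ F, ∑ b ∈ F, q (a - b)) : 0 ≤ ∑' l, q l := by
  classical
  by_contra! hneg
  set L := ∑' l, q l with hL
  set T := ∑' l, |q l| with hT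
  have hT0 : 0 ≤ T := tsum_nonneg fun _ ↦ abs_nonneg _
  obtain ⟨S, hS⟩ :=
    (hq.hasSum.eventually_lt_const (show L < L / 2 by linarith)).exists_forall_of_atTop
  have hκ : 0 < -L / (4 * (T - L)) := by
    apply div_pos <;> linarith
  obtain ⟨F, hF, hbad⟩ := exists_folner S hκ
  have hshift (b : G) : ∑ a ∈ F, q (a - b) = ∑ l ∈ F.image (fun a ↦ a - b), q l := by
    rw [Finset.sum_image fun x _ y _ hxy ↦ sub_left_injective hxy]
  have hgood : ∀ b ∈ F.filter (fun b ↦ ∀ l ∈ S, b + l ∈ F), ∑ a ∈ F, q (a - b) ≤ L / 2 :=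
    fun b hb ↦ by
      rw [hshift]
      refine (hS _ fun l hl ↦ ?_).le
      exact Finset.mem_image.2 ⟨b + l, (Finset.mem_filter.1 hb).2 l hl, by abel⟩
  have hany : ∀ b ∈ F.filter (fun b ↦ ¬ ∀ l ∈ S, b + l ∈ F), ∑ a ∈ F, q (a - b) ≤ T :=
    fun b _ ↦ by
      rw [hshift]
      exact (Finset.sum_le_sum fun l _ ↦ le_abs_self (q l)).trans
        (hq.abs.sum_le_tsum _ fun _ _ ↦ abs_nonneg _)
  have h1 := hpos F
  rw [Finset.sum_comm, ← Finset.sum_filter_add_sum_filter_not F (fun b ↦ ∀ l ∈ S, b + l ∈ F)] at h1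
  have h2 := Finset.sum_le_card_nsmul _ _ _ hgood
  have h3 := Finset.sum_le_card_nsmul _ _ _ hany
  have h4 : ((F.filter fun b ↦ ∀ l ∈ S, b + l ∈ F).card : ℝ) +
      (F.filter fun b ↦ ¬ ∀ l ∈ S, b + l ∈ F).card = F.card := by
    exact_mod_cast Finset.card_filter_add_card_filter_not (s := F) (fun b ↦ ∀ l ∈ S, b + l ∈ F)
  have hFpos : (0 : ℝ) < F.card := by exact_mod_cast hF.card_pos
  rw [nsmul_eq_mul] at h2 h3
  set g : ℝ := ((F.filter fun b ↦ ∀ l ∈ S, b + l ∈ F).card : ℝ)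
  set d : ℝ := ((F.filter fun b ↦ ¬ ∀ l ∈ S, b + l ∈ F).card : ℝ)
  have hd0 : 0 ≤ d := Nat.cast_nonneg _
  have h5 : d * (T - L) ≤ -L / 4 * F.card := by
    have hTL : 0 < T - L := by linarith
    calc d * (T - L) ≤ (-L / (4 * (T - L)) * F.card) * (T - L) := by gcongr
      _ = -L / 4 * F.card := by field_simp
  have h6 : 0 ≤ g * (L / 2) + d * T := by linarith
  have h7 : g = F.card - d := by linarith
  rw [h7] at h6
  nlinarith

/-- The terms of the partial fraction expansion of the logarithmic derivative of `riemannZeta₁`. -/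
noncomputable def zetaZeroTerm (w ρ : ℂ) : ℂ :=
  (analyticOrderNatAt riemannZeta₁ ρ : ℂ) * (1 / (w - ρ) - 1 / (1 - ρ))

lemma half_add_mul_I_injective : Function.Injective fun l : ℝ ↦ (1 / 2 + l * Complex.I : ℂ) :=
  fun a b h ↦ by simpa using congrArg Complex.im h

lemma mertensResidue_one_div_eq {w : ℝ} (hw : 1 < w) (l : ℝ) :
    mertensResidue 1 l / ((w - 1 / 2 : ℝ) - (l : ℂ) * Complex.I) =
      -(w - 1 : ℂ)⁻¹ * zetaZeroTerm w (1 / 2 + l * Complex.I) +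
        if l = 0 then ((w - 1 / 2 : ℝ) : ℂ)⁻¹ else 0 := by
  have h1 : ((w - 1 / 2 : ℝ) - (l : ℂ) * Complex.I) ≠ 0 := fun h ↦ by
    have := congrArg Complex.re h
    simp at this
    linarith
  have h2 := half_sub_mul_I_ne_zero l
  have h3 : (w - 1 : ℂ) ≠ 0 := by
    rw [sub_ne_zero]
    exact_mod_cast hw.ne'
  rw [mertensResidue, zetaZeroTerm,
    show (w : ℂ) - (1 / 2 + l * Complex.I) = (w - 1 / 2 : ℝ) - l * Complex.I by push_cast; ring,
    show (1 : ℂ) - (1 / 2 + l * Complex.I) = 1 / 2 - l * Complex.I by ring,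
    div_sub_div _ _ h1 h2, div_div, Complex.ofReal_one, one_mul, add_div]
  have hz : (if l = 0 then (1 / 2 : ℂ) else 0) /
      ((1 / 2 - l * Complex.I) * ((w - 1 / 2 : ℝ) - l * Complex.I)) =
      if l = 0 then ((w - 1 / 2 : ℝ) : ℂ)⁻¹ else 0 := by
    split_ifs with hl
    · subst hl
      rw [Complex.ofReal_zero, zero_mul, sub_zero, sub_zero, div_mul_eq_div_div,
        div_self (by norm_num), one_div]
    · rw [zero_div]
  rw [hz]
  congr 1
  rw [show 1 * (1 / 2 - l * Complex.I) - ((w - 1 / 2 : ℝ) - l * Complex.I) * 1 = -(w - 1 : ℂ) by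
    push_cast; ring]
  generalize ((w - 1 / 2 : ℝ) - (l : ℂ) * Complex.I) = a at h1
  generalize (1 / 2 - (l : ℂ) * Complex.I) = b at h2
  field_simp

lemma summable_zetaZeroTerm {w : ℝ} (hw : 1 < w) : Summable (zetaZeroTerm w) :=
  (hasSum_logDeriv_riemannZeta₁ (riemannZeta₁_ne_zero_of_one_le_re (s := w)
    (by simpa using hw.le))).summable

lemma IsMertensMeasure.tsum_zetaZeroTerm_re_le {C X : ℝ} {μ : Measure ℝ}
    (h : IsMertensMeasure 1 C X μ) {w : ℝ} (hw : 1 < w) :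
    ∑' l : ℝ, (zetaZeroTerm w (1 / 2 + l * Complex.I)).re ≤ 1 := by
  have hs : Summable fun l : ℝ ↦ (zetaZeroTerm w (1 / 2 + l * Complex.I)).re :=
    ((Complex.hasSum_re (summable_zetaZeroTerm hw).hasSum).summable).comp_injective
      half_add_mul_I_injective
  have hsum : HasSum (fun l : ℝ ↦
      (mertensResidue 1 l / ((w - 1 / 2 : ℝ) - (l : ℂ) * Complex.I)).re)
      (-(w - 1)⁻¹ * ∑' l : ℝ, (zetaZeroTerm w (1 / 2 + l * Complex.I)).re + (w - 1 / 2)⁻¹) := by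
    refine ((hs.hasSum.mul_left (-(w - 1)⁻¹)).add
      (hasSum_ite_eq (0 : ℝ) (w - 1 / 2)⁻¹)).congr_fun fun l ↦ ?_
    rw [mertensResidue_one_div_eq hw, Complex.add_re]
    congr 1
    · rw [show (-(w - 1 : ℂ)⁻¹) = ((-(w - 1)⁻¹ : ℝ) : ℂ) by push_cast; rfl,
        Complex.re_ofReal_mul]
    · split_ifs
      · rw [← Complex.ofReal_inv, Complex.ofReal_re]
      · simp
  have hnn := tsum_nonneg_of_positive_type hsum.summable fun F ↦
    h.sum_mertensResidue_div_re_nonneg (show 0 < w - 1 / 2 by linarith) F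
  rw [hsum.tsum_eq] at hnn
  set A := ∑' l : ℝ, (zetaZeroTerm w (1 / 2 + l * Complex.I)).re
  have h1 : 0 < w - 1 := by linarith
  have h2 : (w - 1)⁻¹ * A ≤ (w - 1 / 2)⁻¹ := by linarith
  have h3 : (w - 1 / 2)⁻¹ ≤ (w - 1)⁻¹ := inv_anti₀ h1 (by linarith)
  have h4 : (w - 1)⁻¹ * A ≤ (w - 1)⁻¹ * 1 := by linarith
  exact le_of_mul_le_mul_left h4 (inv_pos.2 h1)

lemma zetaZeroTerm_trivial_re_le {w : ℝ} (hw : 1 < w) (n : ℕ) :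
    (zetaZeroTerm w (-2 * (n + 1))).re ≤ 1 / (w + 2 * n + 2) - 1 / (2 * n + 3) := by
  have hm : (1 : ℝ) ≤ analyticOrderNatAt riemannZeta₁ (-2 * (n + 1)) := by
    exact_mod_cast one_le_analyticOrderNatAt_of_zero (riemannZeta₁_neg_two_mul_nat_add_one n)
  have heq : zetaZeroTerm w (-2 * (n + 1)) =
      (((analyticOrderNatAt riemannZeta₁ (-2 * (n + 1)) : ℝ) *
        (1 / (w + 2 * n + 2) - 1 / (2 * n + 3)) : ℝ) : ℂ) := by
    rw [zetaZeroTerm]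
    push_cast
    ring_nf
  have hneg : 1 / (w + 2 * n + 2) - 1 / (2 * n + 3 : ℝ) ≤ 0 := by
    rw [sub_nonpos]
    exact one_div_le_one_div_of_le (by positivity) (by linarith)
  rw [heq, Complex.ofReal_re]
  nlinarith

lemma IsMertensMeasure.logDeriv_sub_re_le {C X : ℝ} {μ : Measure ℝ}
    (h : IsMertensMeasure 1 C X μ) {w : ℝ} (hw : 1 < w) (N : ℕ) :
    (logDeriv riemannZeta₁ w - logDeriv riemannZeta₁ 1).re ≤
      1 + ∑ n ∈ Finset.range N, (1 / (w + 2 * n + 2) - 1 / (2 * n + 3 : ℝ)) := by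
  classical
  have hsum := Complex.hasSum_re (hasSum_logDeriv_riemannZeta₁
    (riemannZeta₁_ne_zero_of_one_le_re (s := w) (by simpa using hw.le)))
  set t : ℂ → ℝ := fun ρ ↦ (zetaZeroTerm w ρ).re with ht
  set s : Set ℂ := {ρ | ρ.re = 1 / 2} with hs
  have htsum : Summable t := hsum.summable
  have hA : ∑' ρ, s.indicator t ρ ≤ 1 := by
    refine le_trans (le_of_eq ?_) (h.tsum_zetaZeroTerm_re_le hw)
    rw [← half_add_mul_I_injective.tsum_eq]
    · refine tsum_congr fun l ↦ ?_
      rw [Set.indicator_of_mem (show _ ∈ s by simp [hs])]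
    · refine (Set.support_indicator_subset).trans fun ρ hρ ↦ ⟨ρ.im, ?_⟩
      have hρ' : ρ.re = 1 / 2 := hρ
      apply Complex.ext <;> simp [hρ']
  have hnonpos (ρ : ℂ) : sᶜ.indicator t ρ ≤ 0 := by
    refine Set.indicator_nonpos (fun ρ hρ ↦ ?_) ρ
    by_cases hz : riemannZeta₁ ρ = 0
    · rcases re_eq_half_or_trivial h.riemannZeta₁_ne_zero hz with hr | ⟨n, rfl⟩
      · exact absurd hr hρ
      · refine (zetaZeroTerm_trivial_re_le hw n).trans ?_
        rw [sub_nonpos]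
        exact one_div_le_one_div_of_le (by positivity) (by linarith)
    · simp [ht, zetaZeroTerm, analyticOrderNatAt_eq_zero_of_ne differentiable_riemannZeta₁ hz]
  have hinj : Set.InjOn (fun n : ℕ ↦ (-2 * (n + 1) : ℂ)) (Finset.range N : Set ℕ) :=
    fun a _ b _ hab ↦ by simpa using hab
  have hB : ∑' ρ, sᶜ.indicator t ρ ≤
      ∑ n ∈ Finset.range N, (1 / (w + 2 * n + 2) - 1 / (2 * n + 3 : ℝ)) := by
    have h1 := (htsum.indicator sᶜ).neg.sum_le_tsum
      ((Finset.range N).image fun n : ℕ ↦ (-2 * (n + 1) : ℂ))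
      fun ρ _ ↦ neg_nonneg.2 (hnonpos ρ)
    rw [tsum_neg, Finset.sum_neg_distrib, neg_le_neg_iff, Finset.sum_image hinj] at h1
    refine h1.trans (Finset.sum_le_sum fun n _ ↦ ?_)
    rw [Set.indicator_of_mem]
    · exact zetaZeroTerm_trivial_re_le hw n
    · intro hn
      have hn' : (-2 * (n + 1) : ℂ).re = 1 / 2 := hn
      simp at hn'
      linarith [(Nat.cast_nonneg n : (0 : ℝ) ≤ n)]
  rw [← hsum.tsum_eq]
  calc ∑' ρ, t ρ = ∑' ρ, (s.indicator t ρ + sᶜ.indicator t ρ) :=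
        tsum_congr fun ρ ↦ (congrFun (Set.indicator_self_add_compl s t) ρ).symm
    _ = ∑' ρ, s.indicator t ρ + ∑' ρ, sᶜ.indicator t ρ :=
        (htsum.indicator s).tsum_add (htsum.indicator sᶜ)
    _ ≤ _ := add_le_add hA hB

lemma exists_le_logDeriv_riemannZeta₁_re :
    ∃ D : ℝ, ∀ w : ℝ, 2 ≤ w → D ≤ (logDeriv riemannZeta₁ w).re := by
  refine ⟨-∑' p : Nat.Primes, (1 - (2 : ℝ) ^ (-2 : ℝ))⁻¹ *
    (Real.log (p : ℕ) * ((p : ℕ) : ℝ) ^ (-((1 : ℕ) * 2 : ℝ))), fun w hw ↦ ?_⟩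
  rw [logDeriv_riemannZeta₁_eq (by rw [Complex.ofReal_re]; linarith), Complex.sub_re]
  have hs : Summable fun p : Nat.Primes ↦ (1 - (2 : ℝ) ^ (-2 : ℝ))⁻¹ *
      (Real.log (p : ℕ) * ((p : ℕ) : ℝ) ^ (-((1 : ℕ) * 2 : ℝ))) :=
    (summable_primes_log_mul_rpow (by norm_num)).mul_left _
  have h1 : ‖primeTail 1 w‖ ≤ _ := tsum_of_norm_bounded hs.hasSum fun p ↦
    norm_primeTailTerm_le 1 (by norm_num) (w := w) (by rwa [Complex.ofReal_re]) p
  have h2 := (Complex.re_le_norm (primeTail 1 w)).trans h1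
  have h3 : 0 ≤ (1 / ((w : ℂ) - 1)).re := by
    rw [show 1 / ((w : ℂ) - 1) = ((1 / (w - 1) : ℝ) : ℂ) by push_cast; rfl, Complex.ofReal_re]
    exact div_nonneg zero_le_one (by linarith)
  linarith

/-- The error term is not eventually nonnegative. -/
lemma not_isMertensMeasure_one {C X : ℝ} {μ : Measure ℝ} :
    ¬ IsMertensMeasure 1 C X μ := fun h ↦ by
  obtain ⟨D, hD⟩ := exists_le_logDeriv_riemannZeta₁_re
  set K := (logDeriv riemannZeta₁ 1).re
  have hdiv : Tendsto (fun N ↦ ∑ n ∈ Finset.range N, 1 / (2 * n + 3 : ℝ)) atTop atTop := by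
    refine tendsto_atTop_mono (fun N ↦ ?_)
      (Real.tendsto_sum_range_one_div_nat_succ_atTop.const_mul_atTop (show (0 : ℝ) < 1 / 3 by
        norm_num))
    rw [Finset.mul_sum]
    refine Finset.sum_le_sum fun n _ ↦ ?_
    rw [one_div_mul_one_div_rev]
    exact one_div_le_one_div_of_le (by positivity)
      (by linarith [(Nat.cast_nonneg n : (0 : ℝ) ≤ n)])
  obtain ⟨N, hN⟩ := (hdiv.eventually_gt_atTop (2 + K - D)).exists
  set w : ℝ := N + 2 with hw
  have hN0 : (0 : ℝ) ≤ N := Nat.cast_nonneg N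
  have h1 := h.logDeriv_sub_re_le (w := w) (by linarith) N
  have h2 := hD w (by linarith)
  have h3 : ∑ n ∈ Finset.range N, 1 / (w + 2 * n + 2) ≤ 1 := by
    calc ∑ n ∈ Finset.range N, 1 / (w + 2 * n + 2)
        ≤ ∑ n ∈ Finset.range N, 1 / w := Finset.sum_le_sum fun n _ ↦
          one_div_le_one_div_of_le (by linarith)
            (by linarith [(Nat.cast_nonneg n : (0 : ℝ) ≤ n)])
      _ = N / w := by rw [Finset.sum_const, Finset.card_range, nsmul_eq_mul, mul_one_div]
      _ ≤ 1 := (div_le_one (by linarith)).2 (by linarith)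
  rw [Complex.sub_re, Finset.sum_sub_distrib] at h1
  linarith

/-- The error term in Mertens's first theorem changes sign infinitely often (Lay):
beyond any bound `X` there are points where it is positive and points where it is
negative. -/
theorem mertensDelta_changes_sign :
    ∀ X : ℝ, ∃ x : ℝ, ∃ y : ℝ, X < x ∧ X < y ∧
      0 < mertensDelta x ∧ mertensDelta y < 0 := by
  intro X
  have hX : 1 < max X 2 := lt_of_lt_of_le one_lt_two (le_max_right _ _)
  have hpos : ∃ x, X < x ∧ 0 < mertensDelta x := by
    by_contra! hcon
    obtain ⟨C, μ, h⟩ := exists_isMertensMeasure (ε := -1) (by simp) hX fun t ht ↦ by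
      linarith [hcon t ((le_max_left _ _).trans_lt ht)]
    exact not_isMertensMeasure_neg_one h
  have hneg : ∃ y, X < y ∧ mertensDelta y < 0 := by
    by_contra! hcon
    obtain ⟨C, μ, h⟩ := exists_isMertensMeasure (ε := 1) (by simp) hX fun t ht ↦ by
      linarith [hcon t ((le_max_left _ _).trans_lt ht)]
    exact not_isMertensMeasure_one h
  obtain ⟨x, hx, hx'⟩ := hpos
  obtain ⟨y, hy, hy'⟩ := hneg
  exact ⟨x, y, hx, hy, hx', hy'⟩
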